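/- If a fullerene graph F_n with n vertices contains a pentagonal ring R_k with 7 ≤ k ≤ 12 as a subgraph, then n ≤ 52. -/

import Mathlib

namespace FG

/-- A combinatorial plane (spherically embedded) graph: a finite simple graph together with
its collection of faces, each face recorded as the finset of edges of its boundary cycle.
Every face boundary is a cycle, every edge lies on exactly two faces, and Euler's formula
holds (edges are counted via the face incidences). -/
structure PlaneGraph (V : Type) [Fintype V] [DecidableEq V] : Type where
  graph : SimpleGraph V
  faces : Finset (Finset (Sym2 V))
  face_edges : ∀ f ∈ faces, ∀ e ∈ f, e ∈ graph.edgeSet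
  face_cycle : ∀ f ∈ faces, ∃ (v : V) (c : graph.Walk v v), c.IsCycle ∧ c.edges.toFinset = f
  edge_faces : ∀ e ∈ graph.edgeSet, (faces.filter (fun f => e ∈ f)).card = 2
  euler : 2 * (Fintype.card V + faces.card) = (∑ f ∈ faces, f.card) + 4

variable {V : Type} [Fintype V] [DecidableEq V]

/-- The vertices incident with at least one edge of an edge set. -/
def edgeVerts (E : Finset (Sym2 V)) : Finset V :=
  Finset.univ.filter fun v => ∃ e ∈ E, v ∈ e

/-- The degree of a vertex in the subgraph spanned by an edge set. -/
def deg (E : Finset (Sym2 V)) (v : V) : ℕ := (E.filter fun e => v ∈ e).card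

/-- The vertices covered by a collection of faces. -/
def facesVerts (H : Finset (Finset (Sym2 V))) : Finset V := edgeVerts (H.sup id)

/-- An edge set is a matching: non-loop edges, pairwise vertex-disjoint. -/
def IsMatching (M : Finset (Sym2 V)) : Prop :=
  (∀ e ∈ M, ¬e.IsDiag) ∧ ∀ e ∈ M, ∀ e' ∈ M, e ≠ e' → ∀ v : V, v ∈ e → v ∉ e'

/-- A fullerene graph: a cubic 3-connected plane graph with (exactly 12) pentagonal
faces and hexagonal faces. -/
structure IsFullerene (P : PlaneGraph V) : Prop where
  cubic : ∀ v : V, (P.graph.neighborSet v).ncard = 3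
  threeConnected : ∀ s : Set V, s.ncard ≤ 2 → (SimpleGraph.induce sᶜ P.graph).Connected
  faceSize : ∀ f ∈ P.faces, f.card = 5 ∨ f.card = 6
  pentTwelve : (P.faces.filter fun f => f.card = 5).card = 12

/-- A fragment of a plane graph: a nonempty set of faces (a cycle together with its
interior) whose boundary — the set of edges lying on exactly one chosen face — is a
single cycle. -/
structure Fragment (P : PlaneGraph V) : Type where
  inFaces : Finset (Finset (Sym2 V))
  nonempty : inFaces.Nonempty
  subFaces : inFaces ⊆ P.faces
  boundary_cycle : ∃ (v : V) (c : P.graph.Walk v v), c.IsCycle ∧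
    c.edges.toFinset =
      (inFaces.sup id).filter fun e => (inFaces.filter fun f => e ∈ f).card = 1

/-- The edge set of a fragment. -/
def Fragment.edges {P : PlaneGraph V} (B : Fragment P) : Finset (Sym2 V) := B.inFaces.sup id

/-- The boundary edges of a fragment. -/
def Fragment.boundary {P : PlaneGraph V} (B : Fragment P) : Finset (Sym2 V) :=
  B.edges.filter fun e => (B.inFaces.filter fun f => e ∈ f).card = 1

/-- A pentagonal fragment: all inner faces are pentagons. -/
def IsPentagonalFragment {P : PlaneGraph V} (B : Fragment P) : Prop :=
  ∀ f ∈ B.inFaces, f.card = 5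

/-- The faces of `P` adjoining the subgraph with edge set `E`: not a face of the
subgraph, but sharing at least one edge with it. -/
def adjoiningFaces (P : PlaneGraph V) (E : Finset (Sym2 V)) : Finset (Finset (Sym2 V)) :=
  P.faces.filter fun f => ¬f ⊆ E ∧ (f ∩ E).Nonempty

/-- The territory `T[G]` of the subgraph with edge set `E`: the subgraph together with
all adjoining faces. -/
def territoryEdges (P : PlaneGraph V) (E : Finset (Sym2 V)) : Finset (Sym2 V) :=
  E ∪ (adjoiningFaces P E).sup id

/-- `w(G)`: the number of 2-degree vertices of the subgraph spanned by `E`. -/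
def wcount (E : Finset (Sym2 V)) : ℕ := ((edgeVerts E).filter fun v => deg E v = 2).card

/-- A subgraph is maximal in `P` when its hexagon extension is contained in `P`,
i.e. every adjoining face is a hexagon. -/
def IsMaximalIn (P : PlaneGraph V) (E : Finset (Sym2 V)) : Prop :=
  ∀ f ∈ adjoiningFaces P E, f.card = 6

/-- `H ∈ 𝒮(G)` for the subgraph `G` with edge set `E`: `H` is a set of mutually disjoint
hexagons of the hexagon extension `H[G]` (hexagonal faces sharing at least one edge with
`G`) such that `G − H` has a matching covering all remaining 3-degree vertices of `G`. -/
def SextetAdm (P : PlaneGraph V) (E : Finset (Sym2 V)) (H : Finset (Finset (Sym2 V))) : Prop :=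
  (∀ f ∈ H, f ∈ P.faces ∧ f.card = 6 ∧ (f ∩ E).Nonempty) ∧
  (∀ f ∈ H, ∀ g ∈ H, f ≠ g → Disjoint (edgeVerts f) (edgeVerts g)) ∧
  ∃ M : Finset (Sym2 V), M ⊆ E ∧ IsMatching M ∧
    (∀ e ∈ M, ∀ v : V, v ∈ e → v ∉ facesVerts H) ∧
    ∀ v ∈ edgeVerts E, deg E v = 3 → v ∉ facesVerts H → ∃ e ∈ M, v ∈ e

/-- `U_H(G) = V(G) ∖ V(H)`. -/
def Uset (E : Finset (Sym2 V)) (H : Finset (Finset (Sym2 V))) : Finset V :=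
  edgeVerts E \ facesVerts H

/-- A Clar set of `H[G]`: a member of `𝒮(G)` minimizing `|U_H(G)|`. -/
def IsClarSet (P : PlaneGraph V) (E : Finset (Sym2 V)) (H : Finset (Finset (Sym2 V))) : Prop :=
  SextetAdm P E H ∧ ∀ H', SextetAdm P E H' → (Uset E H).card ≤ (Uset E H').card

/-- A normal Clar set: a Clar set such that `G − H` has a perfect matching. -/
def IsNormalClarSet (P : PlaneGraph V) (E : Finset (Sym2 V))
    (H : Finset (Finset (Sym2 V))) : Prop :=
  IsClarSet P E H ∧ ∃ M : Finset (Sym2 V), M ⊆ E ∧ IsMatching M ∧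
    (∀ e ∈ M, ∀ v : V, v ∈ e → v ∉ facesVerts H) ∧
    ∀ v ∈ Uset E H, ∃ e ∈ M, v ∈ e

/-- The pentagonal faces of the subgraph with edge set `E`. -/
def pentFaces (P : PlaneGraph V) (E : Finset (Sym2 V)) : Finset (Finset (Sym2 V)) :=
  P.faces.filter fun f => f.card = 5 ∧ f ⊆ E

/-- A subgraph with `k` pentagons is extremal if `|U_H(G)| = k` for a Clar set `H`. -/
def IsExtremalSub (P : PlaneGraph V) (E : Finset (Sym2 V)) : Prop :=
  ∃ H, IsClarSet P E H ∧ (Uset E H).card = (pentFaces P E).card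

/-- A pentagonal ring `R_k`: `k` pentagonal faces `R 0, …, R (k-1)` such that
`R i` and `R j` intersect iff `|i − j| = 1 (mod k)`. -/
def IsPentRing (P : PlaneGraph V) (k : ℕ) (R : ZMod k → Finset (Sym2 V)) : Prop :=
  Function.Injective R ∧ (∀ i, R i ∈ P.faces ∧ (R i).card = 5) ∧
  ∀ i j : ZMod k, i ≠ j →
    ((edgeVerts (R i) ∩ edgeVerts (R j)).Nonempty ↔ (j = i + 1 ∨ i = j + 1))

/-- The number of pentagons of the pentagonal fragment `B` adjoining (sharing an edge
with) the pentagon `p`. -/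
def pentAdjCount {P : PlaneGraph V} (B : Fragment P) (p : Finset (Sym2 V)) : ℕ :=
  (B.inFaces.filter fun q => q ≠ p ∧ (q ∩ p).Nonempty).card

/-- The fragment consisting of a single pentagon `P`. -/
def IsPentagonFrag {P : PlaneGraph V} (B : Fragment P) : Prop :=
  IsPentagonalFragment B ∧ B.inFaces.card = 1

/-- `B_2`: the extremal pentagonal fragment with 4 pentagons whose Clar extension is
normal. -/
def IsB2Frag {P : PlaneGraph V} (B : Fragment P) : Prop :=
  IsPentagonalFragment B ∧ B.inFaces.card = 4 ∧ IsExtremalSub P B.edges ∧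
    ∃ H, IsNormalClarSet P B.edges H

/-- `B_3`: the extremal pentagonal fragment with 6 pentagons whose Clar extension is
normal. -/
def IsB3Frag {P : PlaneGraph V} (B : Fragment P) : Prop :=
  IsPentagonalFragment B ∧ B.inFaces.card = 6 ∧ IsExtremalSub P B.edges ∧
    ∃ H, IsNormalClarSet P B.edges H

/-- A pasting edge of the subgraph with edge set `E`: an edge of `E` lying on the
boundary of the Clar extension `C[G]` (not an edge of a Clar hexagon) whose two
end-vertices belong to `V(H)` for a Clar set `H`. -/
def IsPastingEdge (P : PlaneGraph V) (E : Finset (Sym2 V)) (e : Sym2 V) : Prop :=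
  e ∈ E ∧ ∃ H, IsClarSet P E H ∧ (∀ v : V, v ∈ e → v ∈ facesVerts H) ∧ e ∉ H.sup id

/-- `B` arises from pasting `A` and `C` along a common pasting edge:
`B = A ∪ C` and `A ∩ C` is a single pasting edge of both. -/
def IsPasting {P : PlaneGraph V} (B A C : Fragment P) : Prop :=
  B.inFaces = A.inFaces ∪ C.inFaces ∧
  ∃ e : Sym2 V, A.edges ∩ C.edges = {e} ∧ IsPastingEdge P A.edges e ∧ IsPastingEdge P C.edges e

def IsBasicFrag {P : PlaneGraph V} (B : Fragment P) : Prop :=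
  IsPentagonFrag B ∨ IsB2Frag B ∨ IsB3Frag B

/-- The pentagonal fragments generated from `P`, `B_2`, `B_3` by the pasting operation. -/
inductive Pasted (P : PlaneGraph V) : Fragment P → Prop
  | base (B : Fragment P) : IsBasicFrag B → Pasted P B
  | paste (B A C : Fragment P) : Pasted P A → IsBasicFrag C → IsPasting B A C → Pasted P B

/-- `P ∗ P`. -/
def IsPPFrag {P : PlaneGraph V} (B : Fragment P) : Prop :=
  ∃ A C : Fragment P, IsPentagonFrag A ∧ IsPentagonFrag C ∧ IsPasting B A C

/-- `P ∗ B_2`. -/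
def IsPB2Frag {P : PlaneGraph V} (B : Fragment P) : Prop :=
  ∃ A C : Fragment P, IsPentagonFrag A ∧ IsB2Frag C ∧ IsPasting B A C

/-- `P ∗ B_2 ∗ P`. -/
def IsPB2PFrag {P : PlaneGraph V} (B : Fragment P) : Prop :=
  ∃ B' A C D : Fragment P, IsPentagonFrag A ∧ IsB2Frag C ∧ IsPentagonFrag D ∧
    IsPasting B' A C ∧ IsPasting B B' D

/-- The six members of `𝓑_{≥60}`. -/
def SixShapes {P : PlaneGraph V} (B : Fragment P) : Prop :=
  IsPentagonFrag B ∨ IsB2Frag B ∨ IsB3Frag B ∨ IsPPFrag B ∨ IsPB2Frag B ∨ IsPB2PFrag B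

/-- `B_1`: two vertex-disjoint pentagons joined by an edge. -/
def IsB1 (P : PlaneGraph V) (E : Finset (Sym2 V)) : Prop :=
  ∃ (f g : Finset (Sym2 V)) (a b : V), f ∈ P.faces ∧ g ∈ P.faces ∧ f.card = 5 ∧ g.card = 5 ∧
    Disjoint (edgeVerts f) (edgeVerts g) ∧ P.graph.Adj a b ∧
    a ∈ edgeVerts f ∧ b ∈ edgeVerts g ∧ E = f ∪ g ∪ {s(a, b)}

/-- `B_1^k`: `k` copies of `B_1` pasted together along pasting edges of their pentagons. -/
inductive B1Pow (P : PlaneGraph V) : ℕ → Finset (Sym2 V) → Prop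
  | one (E : Finset (Sym2 V)) : IsB1 P E → B1Pow P 1 E
  | succ (k : ℕ) (E X : Finset (Sym2 V)) (e : Sym2 V) (f g : Finset (Sym2 V)) :
      B1Pow P k E → IsB1 P X → E ∩ X = {e} → f ∈ P.faces → g ∈ P.faces →
      f.card = 5 → g.card = 5 → f ⊆ E → g ⊆ X → e ∈ f → e ∈ g →
      IsPastingEdge P f e → IsPastingEdge P g e → B1Pow P (k + 1) (E ∪ X)

/-- `F` contains `B_1^k` for some `2 ≤ k ≤ 4` as a subgraph. -/
def ContainsB1Pow (P : PlaneGraph V) : Prop :=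
  ∃ (k : ℕ) (E : Finset (Sym2 V)), 2 ≤ k ∧ k ≤ 4 ∧ B1Pow P k E

/-- A perfect matching of the plane graph `P`. -/
def IsPerfectMatching (P : PlaneGraph V) (M : Finset (Sym2 V)) : Prop :=
  (∀ e ∈ M, e ∈ P.graph.edgeSet) ∧ IsMatching M ∧ ∀ v : V, ∃ e ∈ M, v ∈ e

/-- A sextet pattern of `P`: mutually disjoint hexagonal faces, all alternating with
respect to a common perfect matching. -/
def IsSextetPattern (P : PlaneGraph V) (H : Finset (Finset (Sym2 V))) : Prop :=
  (∀ f ∈ H, f ∈ P.faces ∧ f.card = 6) ∧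
  (∀ f ∈ H, ∀ g ∈ H, f ≠ g → Disjoint (edgeVerts f) (edgeVerts g)) ∧
  ∃ M : Finset (Sym2 V), IsPerfectMatching P M ∧ ∀ f ∈ H, (f ∩ M).card = 3

/-- A Clar formula: a maximum sextet pattern. -/
def IsClarFormula (P : PlaneGraph V) (H : Finset (Finset (Sym2 V))) : Prop :=
  IsSextetPattern P H ∧ ∀ H', IsSextetPattern P H' → H'.card ≤ H.card

/-- An extremal fullerene graph: the Clar number equals `(n − 12)/6`. -/
def IsExtremalFullerene (P : PlaneGraph V) : Prop :=
  ∃ H, IsClarFormula P H ∧ 6 * H.card = Fintype.card V - 12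

/-- The edges of the union of all maximal pentagonal fragments of `P`. -/
noncomputable def maxPentEdges (P : PlaneGraph V) : Finset (Sym2 V) :=
  @Finset.filter _
    (fun e => ∃ B : Fragment P, IsPentagonalFragment B ∧ IsMaximalIn P B.edges ∧ e ∈ B.edges)
    (Classical.decPred _) (P.faces.sup id)

/-- The disjoint union of two copies of `K_2`. -/
def twoK2 : SimpleGraph (Fin 4) := SimpleGraph.fromEdgeSet {s(0, 1), s(2, 3)}

/-- The tree `T_0` on six vertices: two adjacent 3-degree vertices, each also adjacent
to two leaves. -/
def treeT0 : SimpleGraph (Fin 6) :=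
  SimpleGraph.fromEdgeSet {s(0, 1), s(0, 2), s(0, 3), s(1, 4), s(1, 5)}


set_option linter.unusedSectionVars false

/-- Number of faces of `C` through `v`. -/
def Q (C : Finset (Finset (Sym2 V))) (v : V) : ℕ := (C.filter fun f => v ∈ edgeVerts f).card

/-- Number of pentagons in `C`. -/
def pc (C : Finset (Finset (Sym2 V))) : ℕ := (C.filter fun f => f.card = 5).card

/-- All edges of the faces in `C`. -/
def EE (C : Finset (Finset (Sym2 V))) : Finset (Sym2 V) := C.biUnion id

/-- Combinatorial abstraction of the face structure of a fullerene. -/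
structure Ful (Fs : Finset (Finset (Sym2 V))) : Prop where
  nd : ∀ e ∈ EE Fs, ¬ e.IsDiag
  cub : ∀ v, deg (EE Fs) v = 3
  two : ∀ e ∈ EE Fs, (Fs.filter fun f => e ∈ f).card = 2
  fdeg : ∀ f ∈ Fs, ∀ v ∈ edgeVerts f, deg f v = 2
  sz : ∀ f ∈ Fs, f.card = 5 ∨ f.card = 6
  twelve : pc Fs = 12
  fcon : ∀ f ∈ Fs, ∀ U : Finset V, ∀ a ∈ edgeVerts f, ∀ b ∈ edgeVerts f, a ∈ U → b ∉ U →
    ∃ x y, s(x, y) ∈ f ∧ x ∈ U ∧ y ∉ U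
  con : ∀ U : Finset V, U.Nonempty → (∀ a b, s(a, b) ∈ EE Fs → a ∈ U → b ∈ U) → U = Finset.univ

theorem mem_EE {C : Finset (Finset (Sym2 V))} {e : Sym2 V} : e ∈ EE C ↔ ∃ f ∈ C, e ∈ f := by
  simp [EE]

theorem mem_ev {E : Finset (Sym2 V)} {v : V} : v ∈ edgeVerts E ↔ ∃ e ∈ E, v ∈ e := by
  simp [edgeVerts]

theorem walk_cross {G : SimpleGraph V} (U : Finset V) {u v : V} (c : G.Walk u v)
    (h : ∀ x y, s(x, y) ∈ c.edges → x ∈ U → y ∈ U) : ∀ w ∈ c.support, (w ∈ U ↔ u ∈ U) := by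
  induction c with
  | nil => simp
  | @cons a b d hab p ih =>
    intro w hw
    have h1 : a ∈ U ↔ b ∈ U := ⟨h a b (by simp), h b a (by simp [Sym2.eq_swap])⟩
    simp only [SimpleGraph.Walk.support_cons, List.mem_cons] at hw
    rcases hw with rfl | hw
    · rfl
    · rw [ih (fun x y hxy => h x y (by simp [hxy])) w hw, h1]

theorem ful_of (P : PlaneGraph V) (hP : IsFullerene P) : Ful P.faces := by
  classical
  have hE : ∀ e, e ∈ EE P.faces ↔ e ∈ P.graph.edgeSet := by
    intro e
    rw [mem_EE]
    constructor
    · rintro ⟨f, hf, he⟩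
      exact P.face_edges f hf e he
    · intro he
      have := P.edge_faces e he
      have h2 : (P.faces.filter (fun f => e ∈ f)).Nonempty := by
        rw [← Finset.card_pos]; omega
      obtain ⟨f, hf⟩ := h2
      simp only [Finset.mem_filter] at hf
      exact ⟨f, hf⟩
  have hsup : ∀ f ∈ P.faces, ∀ (v : V) (c : P.graph.Walk v v), c.IsCycle →
      c.edges.toFinset = f → ∀ w, w ∈ edgeVerts f ↔ w ∈ c.support := by
    intro f hf v c hc hcf w
    rw [mem_ev]
    constructor
    · rintro ⟨e, he, hw⟩
      rw [← hcf, List.mem_toFinset] at he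
      induction e with
      | _ x y =>
        rcases Sym2.mem_iff.1 hw with rfl | rfl
        · exact SimpleGraph.Walk.fst_mem_support_of_mem_edges c he
        · exact SimpleGraph.Walk.snd_mem_support_of_mem_edges c he
    · intro hw
      have h2 := hc.ncard_neighborSet_toSubgraph_eq_two hw
      have h3 : (c.toSubgraph.neighborSet w).Nonempty := by
        rw [Set.nonempty_iff_ne_empty]
        intro h
        rw [h] at h2
        simp at h2
      obtain ⟨x, hx⟩ := h3
      refine ⟨s(w, x), ?_, by simp⟩
      rw [← hcf, List.mem_toFinset]
      rw [SimpleGraph.Subgraph.mem_neighborSet] at hx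
      exact (SimpleGraph.Walk.adj_toSubgraph_iff_mem_edges).1 hx
  refine ⟨?_, ?_, ?_, ?_, hP.faceSize, hP.pentTwelve, ?_, ?_⟩
  · intro e he
    exact P.graph.not_isDiag_of_mem_edgeSet ((hE e).1 he)
  · intro v
    rw [← hP.cubic v, deg, ← Set.ncard_coe_finset]
    symm
    apply Set.ncard_congr (fun w _ => s(v, w))
    · intro w hw
      simp only [Finset.coe_filter, Set.mem_ofPred_eq, hE]
      exact ⟨hw, by simp⟩
    · intro a b _ _ hab
      exact Sym2.congr_right.1 hab
    · intro e he
      simp only [Finset.coe_filter, Set.mem_ofPred_eq, hE] at he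
      obtain ⟨he, hv⟩ := he
      obtain ⟨w, rfl⟩ := hv
      exact ⟨w, he, rfl⟩
  · intro e he
    exact P.edge_faces e ((hE e).1 he)
  · intro f hf v hv
    obtain ⟨x, c, hc, hcf⟩ := P.face_cycle f hf
    have h2 := hc.ncard_neighborSet_toSubgraph_eq_two ((hsup f hf x c hc hcf v).1 hv)
    rw [← h2, deg, ← Set.ncard_coe_finset]
    symm
    apply Set.ncard_congr (fun w _ => s(v, w))
    · intro w hw
      rw [SimpleGraph.Subgraph.mem_neighborSet] at hw
      have := (SimpleGraph.Walk.adj_toSubgraph_iff_mem_edges).1 hw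
      rw [Finset.coe_filter, Set.mem_ofPred_eq, ← hcf, List.mem_toFinset]
      exact ⟨this, by simp⟩
    · intro a b _ _ hab
      exact Sym2.congr_right.1 hab
    · intro e he
      rw [Finset.coe_filter, Set.mem_ofPred_eq, ← hcf, List.mem_toFinset] at he
      obtain ⟨he, hv⟩ := he
      obtain ⟨w, rfl⟩ := hv
      refine ⟨w, ?_, rfl⟩
      rw [SimpleGraph.Subgraph.mem_neighborSet]
      exact (SimpleGraph.Walk.adj_toSubgraph_iff_mem_edges).2 he
  · intro f hf U a ha b hb haU hbU
    obtain ⟨x, c, hc, hcf⟩ := P.face_cycle f hf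
    by_contra hcon
    push Not at hcon
    have := walk_cross U c (fun x y hxy hx => hcon x y (by
      rw [← hcf, List.mem_toFinset]; exact hxy) hx)
    have h1 := this a ((hsup f hf x c hc hcf a).1 ha)
    have h2 := this b ((hsup f hf x c hc hcf b).1 hb)
    tauto
  · intro U hU hcl
    obtain ⟨a, ha⟩ := hU
    ext b
    simp only [Finset.mem_univ, iff_true]
    have h0 := hP.threeConnected ∅ (by simp)
    have ha' : a ∈ (∅ : Set V)ᶜ := by simp
    have hb' : b ∈ (∅ : Set V)ᶜ := by simp
    obtain ⟨p⟩ := h0.preconnected ⟨a, ha'⟩ ⟨b, hb'⟩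
    let q := p.map (SimpleGraph.Embedding.induce (∅ : Set V)ᶜ).toHom
    have := walk_cross U q (fun x y hxy hx => hcl x y (by
      rw [hE]; exact q.edges_subset_edgeSet hxy) hx)
    exact (this b q.end_mem_support).2 ha

theorem deg_sum (S : Finset V) (X : Finset (Sym2 V)) :
    ∑ v ∈ S, deg X v = ∑ e ∈ X, (S.filter fun v => v ∈ e).card := by
  unfold deg
  exact Finset.sum_card_bipartiteAbove_eq_sum_card_bipartiteBelow (fun (v : V) (e : Sym2 V) => v ∈ e)

theorem ends_two (e : Sym2 V) (he : ¬ e.IsDiag) :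
    (Finset.univ.filter fun v : V => v ∈ e).card = 2 := by
  induction e with
  | _ a b =>
    have hab : a ≠ b := by simpa using he
    have : (Finset.univ.filter fun v : V => v ∈ s(a, b)) = {a, b} := by
      ext v; simp
    rw [this, Finset.card_pair hab]

theorem deg_zero {X : Finset (Sym2 V)} {v : V} (h : v ∉ edgeVerts X) : deg X v = 0 := by
  rw [deg, Finset.card_eq_zero, Finset.filter_eq_empty_iff]
  intro e he hv
  exact h (mem_ev.2 ⟨e, he, hv⟩)

theorem deg_total (X : Finset (Sym2 V)) (hX : ∀ e ∈ X, ¬ e.IsDiag) :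
    ∑ v, deg X v = 2 * X.card := by
  rw [deg_sum, Finset.sum_congr rfl (fun e he => ends_two e (hX e he))]
  simp [mul_comm]

theorem Q_sum (C : Finset (Finset (Sym2 V))) :
    ∑ v, Q C v = ∑ f ∈ C, (edgeVerts f).card := by
  unfold Q
  have := Finset.sum_card_bipartiteAbove_eq_sum_card_bipartiteBelow
    (s := (Finset.univ : Finset V)) (t := C) (fun v f => v ∈ edgeVerts f)
  simp only [Finset.bipartiteAbove, Finset.bipartiteBelow] at this
  rw [this]
  apply Finset.sum_congr rfl
  intro f _
  congr 1
  ext v; simp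


theorem Ful.fnd {Fs : Finset (Finset (Sym2 V))} (h : Ful Fs) {f : Finset (Sym2 V)} (hf : f ∈ Fs) : ∀ e ∈ f, ¬ e.IsDiag :=
  fun e he => h.nd e (mem_EE.2 ⟨f, hf, he⟩)

theorem Ful.cardv {Fs : Finset (Finset (Sym2 V))} (h : Ful Fs) {f : Finset (Sym2 V)} (hf : f ∈ Fs) : (edgeVerts f).card = f.card := by
  have h1 := deg_total f (h.fnd hf)
  have h2 : ∑ v, deg f v = ∑ v ∈ edgeVerts f, deg f v := by
    symm
    apply Finset.sum_subset (Finset.subset_univ _)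
    intro v _ hv
    exact deg_zero hv
  rw [h2, Finset.sum_congr rfl (fun v hv => h.fdeg f hf v hv)] at h1
  simp at h1
  omega

theorem Ful.sum_card {Fs : Finset (Finset (Sym2 V))} (h : Ful Fs) {C : Finset (Finset (Sym2 V))} (hC : C ⊆ Fs) :
    ∑ v, (Q C v : ℤ) = 6 * (C.card : ℤ) - pc C := by
  have h1 := Q_sum C
  rw [Finset.sum_congr rfl (fun f hf => h.cardv (hC hf))] at h1
  have h2 : ∑ f ∈ C, (f.card + if f.card = 5 then 1 else 0) = ∑ f ∈ C, 6 := by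
    apply Finset.sum_congr rfl
    intro f hf
    rcases h.sz f (hC hf) with h | h <;> simp [h]
  rw [Finset.sum_add_distrib, ← h1] at h2
  have h3 : (∑ f ∈ C, if f.card = 5 then 1 else 0) = pc C := by
    simp [pc]
  rw [h3] at h2
  simp at h2
  have : ((∑ v, Q C v : ℕ) : ℤ) = ∑ v, (Q C v : ℤ) := by push_cast; rfl
  rw [← this]
  omega

theorem Ful.Q3 {Fs : Finset (Finset (Sym2 V))} (h : Ful Fs) (v : V) : Q Fs v = 3 := by
  have h1 := Finset.sum_card_bipartiteAbove_eq_sum_card_bipartiteBelow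
    (s := (EE Fs).filter fun e => v ∈ e) (t := Fs) (fun e f => e ∈ f)
  simp only [Finset.bipartiteAbove, Finset.bipartiteBelow] at h1
  rw [Finset.sum_congr rfl (fun e he => h.two e (Finset.mem_filter.1 he).1)] at h1
  have h2 : ∀ f ∈ Fs, (((EE Fs).filter fun e => v ∈ e).filter fun e => e ∈ f).card
      = if v ∈ edgeVerts f then 2 else 0 := by
    intro f hf
    have : (((EE Fs).filter fun e => v ∈ e).filter fun e => e ∈ f) = f.filter fun e => v ∈ e := by
      ext e
      simp only [Finset.mem_filter, mem_EE]
      constructor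
      · tauto
      · intro ⟨a, b⟩
        exact ⟨⟨⟨f, hf, a⟩, b⟩, a⟩
    rw [this]
    split_ifs with hv
    · exact h.fdeg f hf v hv
    · exact deg_zero hv
  rw [Finset.sum_congr rfl h2] at h1
  have h3 := h.cub v
  unfold deg at h3
  simp [h3, ← Finset.sum_filter] at h1
  unfold Q
  omega

/-- crossing parity -/
theorem Ful.par {Fs : Finset (Finset (Sym2 V))} (h : Ful Fs) {f : Finset (Sym2 V)} (hf : f ∈ Fs) (U : Finset V) :
    Even ((f.filter fun e => (U.filter fun v => v ∈ e).card = 1).card) := by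
  have h1 := deg_sum U f
  have h2 : Even (∑ v ∈ U, deg f v) := by
    apply Finset.even_sum
    intro v _
    by_cases hv : v ∈ edgeVerts f
    · rw [h.fdeg f hf v hv]; decide
    · rw [deg_zero hv]; decide
  rw [h1, ← Finset.sum_filter_add_sum_filter_not f
    (fun e => (U.filter fun v => v ∈ e).card = 1)] at h2
  rw [Finset.sum_congr rfl (g := fun _ => 1) (fun e he => (Finset.mem_filter.1 he).2)] at h2
  have h3 : Even (∑ e ∈ f.filter (fun e => ¬ (U.filter fun v => v ∈ e).card = 1),
      (U.filter fun v => v ∈ e).card) := by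
    apply Finset.even_sum
    intro e he
    obtain ⟨he, h1⟩ := Finset.mem_filter.1 he
    have h4 := ends_two e (h.fnd hf e he)
    have h5 : (U.filter fun v => v ∈ e).card ≤ (Finset.univ.filter fun v : V => v ∈ e).card :=
      Finset.card_le_card (Finset.filter_subset_filter _ (Finset.subset_univ _))
    have : (U.filter fun v => v ∈ e).card = 0 ∨ (U.filter fun v => v ∈ e).card = 2 := by omega
    rcases this with h | h <;> rw [h] <;> decide
  rw [Nat.even_add] at h2
  simpa using h2.2 h3

theorem Ful.cross2 {Fs : Finset (Finset (Sym2 V))} (h : Ful Fs) {f : Finset (Sym2 V)} (hf : f ∈ Fs) (U : Finset V) {a b : V}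
    (ha : a ∈ edgeVerts f) (hb : b ∈ edgeVerts f) (haU : a ∈ U) (hbU : b ∉ U) :
    2 ≤ (f.filter fun e => (U.filter fun v => v ∈ e).card = 1).card := by
  have h1 := h.par hf U
  obtain ⟨x, y, hxy, hx, hy⟩ := h.fcon f hf U a ha b hb haU hbU
  have h2 : s(x, y) ∈ (f.filter fun e => (U.filter fun v => v ∈ e).card = 1) := by
    rw [Finset.mem_filter]
    refine ⟨hxy, ?_⟩
    rw [Finset.card_eq_one]
    refine ⟨x, ?_⟩
    ext v
    simp only [Finset.mem_filter, Sym2.mem_iff, Finset.mem_singleton]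
    constructor
    · rintro ⟨h1, rfl | rfl⟩
      · rfl
      · exact absurd h1 hy
    · rintro rfl
      exact ⟨hx, Or.inl rfl⟩
  have h3 := Finset.card_pos.2 ⟨_, h2⟩
  obtain ⟨m, hm⟩ := h1
  omega

theorem Ful.share {Fs : Finset (Finset (Sym2 V))} (h : Ful Fs) {f g : Finset (Sym2 V)}
    (hf : f ∈ Fs) (hg : g ∈ Fs) {v : V} (hvf : v ∈ edgeVerts f) (hvg : v ∈ edgeVerts g) :
    ∃ e ∈ f, e ∈ g ∧ v ∈ e := by
  by_contra hcon
  push Not at hcon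
  have h1 := h.fdeg f hf v hvf
  have h2 := h.fdeg g hg v hvg
  have h3 := h.cub v
  unfold deg at h1 h2 h3
  have hd : Disjoint (f.filter fun e => v ∈ e) (g.filter fun e => v ∈ e) := by
    rw [Finset.disjoint_left]
    intro e he hge
    rw [Finset.mem_filter] at he hge
    exact hcon e he.1 hge.1 he.2
  have h4 := Finset.card_union_of_disjoint hd
  have h5 : (f.filter fun e => v ∈ e) ∪ (g.filter fun e => v ∈ e) ⊆
      (EE Fs).filter fun e => v ∈ e := by
    intro e he
    simp only [Finset.mem_union, Finset.mem_filter, mem_EE] at he ⊢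
    rcases he with he | he
    · exact ⟨⟨f, hf, he.1⟩, he.2⟩
    · exact ⟨⟨g, hg, he.1⟩, he.2⟩
  have h6 := Finset.card_le_card h5
  omega

theorem Ful.exface {Fs : Finset (Finset (Sym2 V))} (h : Ful Fs) (v : V) :
    ∃ f ∈ Fs, v ∈ edgeVerts f := by
  have h1 := h.Q3 v
  unfold Q at h1
  have : (Fs.filter fun f => v ∈ edgeVerts f).Nonempty := by
    rw [← Finset.card_pos]; omega
  obtain ⟨f, hf⟩ := this
  rw [Finset.mem_filter] at hf
  exact ⟨f, hf⟩

theorem Ful.fne {Fs : Finset (Finset (Sym2 V))} (h : Ful Fs) {f : Finset (Sym2 V)}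
    (hf : f ∈ Fs) : ∃ v, v ∈ edgeVerts f := by
  have h1 := h.cardv hf
  have h2 := h.sz f hf
  have : (edgeVerts f).Nonempty := by
    rw [← Finset.card_pos]; omega
  exact this

theorem Ful.bdry {Fs : Finset (Finset (Sym2 V))} (h : Ful Fs) {D : Finset (Finset (Sym2 V))}
    (hD : D ⊆ Fs) (hne : D.Nonempty) (hpr : D ≠ Fs) :
    ∃ f ∈ D, ∃ e ∈ f, ∀ g ∈ D, e ∈ g → g = f := by
  by_contra hcon
  push Not at hcon
  have hall : ∀ f ∈ D, ∀ e ∈ f, ∀ g ∈ Fs, e ∈ g → g ∈ D := by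
    intro f hf e he g hg heg
    obtain ⟨g', hg', heg', hne⟩ := hcon f hf e he
    have h2 := h.two e (mem_EE.2 ⟨f, hD hf, he⟩)
    by_contra hgD
    have h3 : ({f, g', g} : Finset (Finset (Sym2 V))) ⊆ Fs.filter fun f => e ∈ f := by
      intro x hx
      simp only [Finset.mem_insert, Finset.mem_singleton] at hx
      rw [Finset.mem_filter]
      rcases hx with rfl | rfl | rfl
      · exact ⟨hD hf, he⟩
      · exact ⟨hD hg', heg'⟩
      · exact ⟨hg, heg⟩
    have h4 := Finset.card_le_card h3
    have h5 : ({f, g', g} : Finset (Finset (Sym2 V))).card = 3 := by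
      rw [Finset.card_eq_three]
      refine ⟨f, g', g, hne.symm, ?_, ?_, rfl⟩
      · rintro rfl; exact hgD hf
      · rintro rfl; exact hgD hg'
    omega
  have hv : ∀ f ∈ D, ∀ v ∈ edgeVerts f, ∀ g ∈ Fs, v ∈ edgeVerts g → g ∈ D := by
    intro f hf v hv g hg hvg
    obtain ⟨e, hef, heg, _⟩ := h.share (hD hf) hg hv hvg
    exact hall f hf e hef g hg heg
  have hU := h.con (edgeVerts (EE D)) (by
      obtain ⟨f, hf⟩ := hne
      obtain ⟨v, hv⟩ := h.fne (hD hf)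
      obtain ⟨e, he, hve⟩ := mem_ev.1 hv
      exact ⟨v, mem_ev.2 ⟨e, mem_EE.2 ⟨f, hf, he⟩, hve⟩⟩) (by
      intro a b hab ha
      obtain ⟨e, he, hae⟩ := mem_ev.1 ha
      obtain ⟨f, hf, hef⟩ := mem_EE.1 he
      obtain ⟨g, hg, hgab⟩ := mem_EE.1 hab
      have := hv f hf a (mem_ev.2 ⟨e, hef, hae⟩) g hg (mem_ev.2 ⟨_, hgab, by simp⟩)
      exact mem_ev.2 ⟨_, mem_EE.2 ⟨g, this, hgab⟩, by simp⟩)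
  apply hpr
  apply Finset.Subset.antisymm hD
  intro g hg
  obtain ⟨v, hvg⟩ := h.fne hg
  have : v ∈ edgeVerts (EE D) := by rw [hU]; simp
  obtain ⟨e, he, hae⟩ := mem_ev.1 this
  obtain ⟨f, hf, hef⟩ := mem_EE.1 he
  exact hv f hf v (mem_ev.2 ⟨e, hef, hae⟩) g hg hvg

theorem reach_mono {X Y : Finset (Sym2 V)} (hXY : X ⊆ Y) {a b : V}
    (hr : (SimpleGraph.fromEdgeSet (X : Set (Sym2 V))).Reachable a b) :
    (SimpleGraph.fromEdgeSet (Y : Set (Sym2 V))).Reachable a b :=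
  hr.mono (SimpleGraph.fromEdgeSet_mono (by exact_mod_cast hXY))

theorem reach_edge {X : Finset (Sym2 V)} {a b : V} (hab : s(a, b) ∈ X) :
    (SimpleGraph.fromEdgeSet (X : Set (Sym2 V))).Reachable a b := by
  by_cases hne : a = b
  · rw [hne]
  · apply SimpleGraph.Adj.reachable
    rw [SimpleGraph.fromEdgeSet_adj]
    exact ⟨hab, hne⟩

theorem Ful.face_reach {Fs : Finset (Finset (Sym2 V))} (h : Ful Fs) {f : Finset (Sym2 V)}
    (hf : f ∈ Fs) {e : Sym2 V} {H : SimpleGraph V}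
    (hr : ∀ a b, s(a, b) ∈ f → s(a, b) ≠ e → H.Reachable a b) :
    ∀ x ∈ edgeVerts f, ∀ y ∈ edgeVerts f, H.Reachable x y := by
  classical
  intro x hx y hy
  by_contra hcon
  let S : Finset V := Finset.univ.filter fun z => H.Reachable x z
  have h1 := h.cross2 hf S (a := x) (b := y) hx hy (by simp [S]) (by simpa [S] using hcon)
  obtain ⟨e', he', hne⟩ := Finset.exists_mem_ne (lt_of_lt_of_le one_lt_two h1) e
  rw [Finset.mem_filter] at he'
  obtain ⟨he'f, h2⟩ := he'
  induction e' with
  | _ a b =>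
    have h3 := hr a b he'f hne
    have hab : a ≠ b := by simpa using h.fnd hf _ he'f
    by_cases ha : a ∈ S
    · have hb : b ∈ S := by
        simp only [S, Finset.mem_filter, Finset.mem_univ, true_and] at ha ⊢
        exact ha.trans h3
      have : (S.filter fun v => v ∈ s(a, b)) = {a, b} := by
        ext v; simp only [Finset.mem_filter, Sym2.mem_iff, Finset.mem_insert,
          Finset.mem_singleton]
        constructor
        · tauto
        · rintro (rfl | rfl) <;> simp [ha, hb]
      rw [this, Finset.card_pair hab] at h2
      omega
    · have hb : b ∉ S := by
        simp only [S, Finset.mem_filter, Finset.mem_univ, true_and] at ha ⊢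
        exact fun hb => ha (hb.trans h3.symm)
      have : (S.filter fun v => v ∈ s(a, b)) = ∅ := by
        ext v; simp only [Finset.mem_filter, Sym2.mem_iff, Finset.notMem_empty, iff_false]
        rintro ⟨hv, rfl | rfl⟩ <;> contradiction
      rw [this] at h2
      simp at h2

theorem Ful.collapse {Fs : Finset (Finset (Sym2 V))} (h : Ful Fs) :
    ∀ D : Finset (Finset (Sym2 V)), D ⊆ Fs → D ≠ Fs → ∃ X ⊆ EE D, X.card = D.card ∧
      ∀ a b, s(a, b) ∈ EE D →
        (SimpleGraph.fromEdgeSet ((EE D \ X : Finset (Sym2 V)) : Set (Sym2 V))).Reachable a b := by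
  intro D
  induction D using Finset.strongInduction with
  | H D ih =>
  intro hD hpr
  by_cases hne : D.Nonempty
  swap
  · rw [Finset.not_nonempty_iff_eq_empty] at hne
    subst hne
    refine ⟨∅, by simp, by simp, ?_⟩
    intro a b hab
    simp [EE] at hab
  obtain ⟨f, hf, e, he, heu⟩ := h.bdry hD hne hpr
  have hsub : D.erase f ⊆ D := Finset.erase_subset _ _
  obtain ⟨X, hX, hXc, hXr⟩ := ih (D.erase f) (Finset.erase_ssubset hf) (hsub.trans hD) (by
    intro heq
    have := hD hf
    rw [← heq] at this
    simp at this)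
  have hEsub : EE (D.erase f) ⊆ EE D := Finset.biUnion_subset_biUnion_of_subset_left _ hsub
  have heE : e ∉ EE (D.erase f) := by
    intro hc
    obtain ⟨g, hg, heg⟩ := mem_EE.1 hc
    rw [Finset.mem_erase] at hg
    exact hg.1 (heu g hg.2 heg)
  have heX : e ∉ X := fun hc => heE (hX hc)
  have heD : e ∈ EE D := mem_EE.2 ⟨f, hf, he⟩
  refine ⟨insert e X, ?_, ?_, ?_⟩
  · intro x hx
    rw [Finset.mem_insert] at hx
    rcases hx with rfl | hx
    · exact heD
    · exact hEsub (hX hx)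
  · rw [Finset.card_insert_of_notMem heX, hXc, Finset.card_erase_add_one hf]
  · have hsub2 : EE (D.erase f) \ X ⊆ EE D \ insert e X := by
      intro x hx
      simp only [Finset.mem_sdiff, Finset.mem_insert, not_or] at hx ⊢
      refine ⟨hEsub hx.1, ?_, hx.2⟩
      rintro rfl
      exact heE hx.1
    have h1 : ∀ a b, s(a, b) ∈ EE D → s(a, b) ≠ e →
        (SimpleGraph.fromEdgeSet ((EE D \ insert e X : Finset (Sym2 V)) :
          Set (Sym2 V))).Reachable a b := by
      intro a b hab hne
      by_cases hin : s(a, b) ∈ EE (D.erase f)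
      · exact reach_mono hsub2 (hXr a b hin)
      · apply reach_edge
        simp only [Finset.mem_sdiff, Finset.mem_insert, not_or]
        exact ⟨hab, hne, fun hc => hin (hX hc)⟩
    intro a b hab
    by_cases hne : s(a, b) = e
    · apply h.face_reach (hD hf) (e := e) (fun a b hab hne => h1 a b (mem_EE.2 ⟨f, hf, hab⟩) hne)
      · exact mem_ev.2 ⟨e, he, by rw [← hne]; simp⟩
      · exact mem_ev.2 ⟨e, he, by rw [← hne]; simp⟩
    · exact h1 a b hab hne

/-- The vertices covered by `D` are connected through edges of `D`. -/
def Conn (D : Finset (Finset (Sym2 V))) : Prop :=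
  ∀ a ∈ edgeVerts (EE D), ∀ b ∈ edgeVerts (EE D),
    (SimpleGraph.fromEdgeSet ((EE D : Finset (Sym2 V)) : Set (Sym2 V))).Reachable a b

theorem reach_of_edges {G H : SimpleGraph V} (hGH : ∀ a b, G.Adj a b → H.Reachable a b) {a b : V}
    (hr : G.Reachable a b) : H.Reachable a b := by
  obtain ⟨p⟩ := hr
  induction p with
  | nil => exact SimpleGraph.Reachable.refl _
  | cons hab p ih => exact (hGH _ _ hab).trans ih

theorem Ful.key0 {Fs : Finset (Finset (Sym2 V))} (h : Ful Fs) {D : Finset (Finset (Sym2 V))}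
    (hD : D ⊆ Fs) (hpr : D ≠ Fs) (hc : Conn D) :
    (edgeVerts (EE D)).card + D.card ≤ (EE D).card + 1 := by
  classical
  obtain ⟨X, hX, hXc, hXr⟩ := h.collapse D hD hpr
  have hXle := Finset.card_le_card hX
  by_cases hne : (edgeVerts (EE D)).Nonempty
  swap
  · rw [Finset.not_nonempty_iff_eq_empty] at hne
    rw [hne]; simp; omega
  obtain ⟨v0, hv0⟩ := hne
  let Z : Finset (Sym2 V) := (Finset.univ \ edgeVerts (EE D)).image fun w => s(v0, w)
  let Y : Finset (Sym2 V) := (EE D \ X) ∪ Z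
  have hconn : (SimpleGraph.fromEdgeSet (Y : Set (Sym2 V))).Connected := by
    have hv : ∀ w, (SimpleGraph.fromEdgeSet (Y : Set (Sym2 V))).Reachable v0 w := by
      intro w
      by_cases hw : w ∈ edgeVerts (EE D)
      · have h1 := hc v0 hv0 w hw
        apply reach_mono (X := EE D \ X) Finset.subset_union_left
        refine reach_of_edges ?_ h1
        intro a b hab
        rw [SimpleGraph.fromEdgeSet_adj] at hab
        exact hXr a b hab.1
      · apply reach_edge
        apply Finset.mem_union_right
        simp only [Z, Finset.mem_image]
        exact ⟨w, by simp [hw], rfl⟩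
    have : Nonempty V := ⟨v0⟩
    exact ⟨fun a b => (hv a).symm.trans (hv b)⟩
  have h1 := hconn.card_vert_le_card_edgeSet_add_one
  have h2 : Nat.card (SimpleGraph.fromEdgeSet (Y : Set (Sym2 V))).edgeSet ≤ Y.card := by
    rw [Nat.card_coe_set_eq, ← Set.ncard_coe_finset]
    apply Set.ncard_le_ncard _ (Finset.finite_toSet _)
    rw [SimpleGraph.edgeSet_fromEdgeSet]
    exact Set.sdiff_subset
  have h3 : Y.card ≤ (EE D \ X).card + Z.card := Finset.card_union_le _ _
  have h4 : Z.card ≤ (Finset.univ \ edgeVerts (EE D)).card := Finset.card_image_le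
  rw [Finset.card_sdiff_of_subset hX] at h3
  rw [Finset.card_sdiff_of_subset (Finset.subset_univ _), Finset.card_univ] at h4
  have h5 : (edgeVerts (EE D)).card ≤ Fintype.card V := Finset.card_le_univ _
  rw [Nat.card_eq_fintype_card] at h1
  omega

/-- Weight function. -/
def ph (j : ℕ) : ℤ := if j = 1 then 1 else if j = 2 then -1 else 0

/-- The curvature-like quantity of a face set. -/
def XX (C : Finset (Finset (Sym2 V))) : ℤ := pc C + ∑ v, ph (Q C v)

theorem Q_pos {C : Finset (Finset (Sym2 V))} {v : V} :
    0 < Q C v ↔ ∃ f ∈ C, v ∈ edgeVerts f := by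
  unfold Q
  rw [Finset.card_pos]
  constructor
  · rintro ⟨f, hf⟩
    rw [Finset.mem_filter] at hf
    exact ⟨f, hf⟩
  · rintro ⟨f, hf, hv⟩
    exact ⟨f, by rw [Finset.mem_filter]; exact ⟨hf, hv⟩⟩

theorem mem_evEE {C : Finset (Finset (Sym2 V))} {v : V} :
    v ∈ edgeVerts (EE C) ↔ ∃ f ∈ C, v ∈ edgeVerts f := by
  simp only [mem_ev, mem_EE]
  constructor
  · rintro ⟨e, ⟨f, hf, he⟩, hv⟩
    exact ⟨f, hf, e, he, hv⟩
  · rintro ⟨f, hf, e, he, hv⟩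
    exact ⟨e, ⟨f, hf, he⟩, hv⟩

theorem Q_sdiff {C D : Finset (Finset (Sym2 V))} (hD : D ⊆ C) (v : V) :
    Q (C \ D) v + Q D v = Q C v := by
  unfold Q
  rw [← Finset.card_union_of_disjoint]
  · congr 1
    ext f
    simp only [Finset.mem_union, Finset.mem_filter, Finset.mem_sdiff]
    constructor
    · rintro (h | h)
      · exact ⟨h.1.1, h.2⟩
      · exact ⟨hD h.1, h.2⟩
    · intro h
      by_cases hf : f ∈ D
      · exact Or.inr ⟨hf, h.2⟩
      · exact Or.inl ⟨⟨h.1, hf⟩, h.2⟩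
  · rw [Finset.disjoint_left]
    intro f hf hg
    simp only [Finset.mem_filter, Finset.mem_sdiff] at hf hg
    exact hf.1.2 hg.1

theorem pc_sdiff {C D : Finset (Finset (Sym2 V))} (hD : D ⊆ C) :
    pc (C \ D) + pc D = pc C := by
  unfold pc
  rw [← Finset.card_union_of_disjoint]
  · congr 1
    ext f
    simp only [Finset.mem_union, Finset.mem_filter, Finset.mem_sdiff]
    constructor
    · rintro (h | h)
      · exact ⟨h.1.1, h.2⟩
      · exact ⟨hD h.1, h.2⟩
    · intro h
      by_cases hf : f ∈ D
      · exact Or.inr ⟨hf, h.2⟩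
      · exact Or.inl ⟨⟨h.1, hf⟩, h.2⟩
  · rw [Finset.disjoint_left]
    intro f hf hg
    simp only [Finset.mem_filter, Finset.mem_sdiff] at hf hg
    exact hf.1.2 hg.1

theorem Q_mono {C D : Finset (Finset (Sym2 V))} (hD : D ⊆ C) (v : V) : Q D v ≤ Q C v :=
  Finset.card_le_card (Finset.filter_subset_filter _ hD)

theorem EE_mono {C D : Finset (Finset (Sym2 V))} (hD : D ⊆ C) : EE D ⊆ EE C :=
  Finset.biUnion_subset_biUnion_of_subset_left _ hD

theorem Ful.Qle {Fs C : Finset (Finset (Sym2 V))} (h : Ful Fs) (hC : C ⊆ Fs) (v : V) :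
    Q C v ≤ 3 := (Q_mono hC v).trans (h.Q3 v).le

theorem Ful.key1 {Fs D : Finset (Finset (Sym2 V))} (h : Ful Fs)
    (hD : D ⊆ Fs) (hpr : D ≠ Fs) (hc : Conn D) : XX D ≤ 6 := by
  have h0 := h.key0 hD hpr hc
  have h1 := deg_total (EE D) (fun e he => h.nd e (EE_mono hD he))
  have h2 := h.sum_card hD
  have h3 : (edgeVerts (EE D)).card = ∑ v : V, if 0 < Q D v then 1 else 0 := by
    rw [Finset.card_eq_sum_ones, ← Finset.sum_filter]
    apply Finset.sum_congr _ (fun _ _ => rfl)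
    ext v
    simp [mem_evEE, Q_pos]
  have h4 : ∀ v : V, ph (Q D v) + 3 * (deg (EE D) v : ℤ) ≤
      6 * ((if 0 < Q D v then 1 else 0 : ℕ) : ℤ) + Q D v := by
    intro v
    have hle := h.Qle hD v
    have hd3 : deg (EE D) v ≤ 3 := by
      rw [← h.cub v]
      exact Finset.card_le_card (Finset.filter_subset_filter _ (EE_mono hD))
    have hd0 : Q D v = 0 → deg (EE D) v = 0 := by
      intro hq
      apply deg_zero
      rw [mem_evEE, ← Q_pos]
      omega
    have hd1 : Q D v = 1 → deg (EE D) v ≤ 2 := by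
      intro hq
      unfold Q at hq
      rw [Finset.card_eq_one] at hq
      obtain ⟨f, hf⟩ := hq
      have hf' : f ∈ D.filter fun f => v ∈ edgeVerts f := by rw [hf]; simp
      rw [Finset.mem_filter] at hf'
      rw [← h.fdeg f (hD hf'.1) v hf'.2]
      apply Finset.card_le_card
      intro e he
      rw [Finset.mem_filter, mem_EE] at he
      obtain ⟨⟨g, hg, heg⟩, hve⟩ := he
      have : g ∈ D.filter fun f => v ∈ edgeVerts f := by
        rw [Finset.mem_filter]; exact ⟨hg, mem_ev.2 ⟨e, heg, hve⟩⟩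
      rw [hf, Finset.mem_singleton] at this
      subst this
      rw [Finset.mem_filter]; exact ⟨heg, hve⟩
    unfold ph
    generalize Q D v = q at *
    generalize deg (EE D) v = d at *
    interval_cases q <;> simp at * <;> omega
  have h5 := Finset.sum_le_sum (s := (Finset.univ : Finset V)) (fun v _ => h4 v)
  rw [Finset.sum_add_distrib, Finset.sum_add_distrib, ← Finset.mul_sum, ← Finset.mul_sum, h2,
    ← Nat.cast_sum, ← Nat.cast_sum, h1, ← h3] at h5
  unfold XX
  push_cast at h5
  omega

theorem ph_compl (a b : ℕ) (hab : a + b = 3) : ph a = - ph b := by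
  have : a ≤ 3 := by omega
  interval_cases a
  · obtain rfl : b = 3 := by omega
    decide
  · obtain rfl : b = 2 := by omega
    decide
  · obtain rfl : b = 1 := by omega
    decide
  · obtain rfl : b = 0 := by omega
    decide

theorem Ful.XX_compl {Fs C : Finset (Finset (Sym2 V))} (h : Ful Fs) (hC : C ⊆ Fs) :
    XX (Fs \ C) + XX C = 12 := by
  unfold XX
  have h1 := pc_sdiff hC
  rw [h.twelve] at h1
  have h2 : ∑ v, ph (Q (Fs \ C) v) = ∑ v, - ph (Q C v) := by
    apply Finset.sum_congr rfl
    intro v _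
    apply ph_compl
    rw [Q_sdiff hC, h.Q3]
  rw [h2, Finset.sum_neg_distrib]
  omega

theorem Ful.key {Fs C : Finset (Finset (Sym2 V))} (h : Ful Fs) (hC : C ⊆ Fs)
    (hne : C.Nonempty) (hc : Conn (Fs \ C)) : 6 ≤ XX C := by
  have h1 := h.XX_compl hC
  have h2 := h.key1 (D := Fs \ C) Finset.sdiff_subset (by
    intro heq
    obtain ⟨f, hf⟩ := hne
    have := hC hf
    rw [← heq, Finset.mem_sdiff] at this
    exact this.2 hf) hc
  omega

theorem Ful.conn_ext {Fs D B : Finset (Finset (Sym2 V))} (h : Ful Fs) (hB : B ⊆ Fs)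
    (hc : Conn D) (hB2 : ∀ f ∈ B, ∃ v ∈ edgeVerts f, ∃ g ∈ D, v ∈ edgeVerts g) :
    Conn (D ∪ B) := by
  have key : ∀ a ∈ edgeVerts (EE (D ∪ B)), ∃ b ∈ edgeVerts (EE D),
      (SimpleGraph.fromEdgeSet ((EE (D ∪ B) : Finset (Sym2 V)) : Set (Sym2 V))).Reachable a b := by
    intro a ha
    rw [mem_evEE] at ha
    obtain ⟨f, hf, haf⟩ := ha
    rw [Finset.mem_union] at hf
    rcases hf with hf | hf
    · exact ⟨a, mem_evEE.2 ⟨f, hf, haf⟩, SimpleGraph.Reachable.refl _⟩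
    · obtain ⟨v, hvf, g, hg, hvg⟩ := hB2 f hf
      refine ⟨v, mem_evEE.2 ⟨g, hg, hvg⟩, ?_⟩
      refine h.face_reach (hB hf) (e := s(a, a)) ?_ a haf v hvf
      intro x y hxy _
      exact reach_edge (mem_EE.2 ⟨f, Finset.mem_union_right _ hf, hxy⟩)
  intro a ha b hb
  obtain ⟨a', ha', hra⟩ := key a ha
  obtain ⟨b', hb', hrb⟩ := key b hb
  exact (hra.trans (reach_mono (EE_mono Finset.subset_union_left) (hc a' ha' b' hb'))).trans
    hrb.symm

/-- Faces of `C` meeting the boundary. -/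
def BB (C : Finset (Finset (Sym2 V))) : Finset (Finset (Sym2 V)) :=
  C.filter fun f => ∃ v ∈ edgeVerts f, Q C v ≤ 2

/-- Faces of `C` with all vertices on the boundary. -/
def KK (C : Finset (Finset (Sym2 V))) : Finset (Finset (Sym2 V)) :=
  C.filter fun f => ∀ v ∈ edgeVerts f, Q C v ≤ 2

/-- Boundary vertices of type two with an interior neighbour. -/
def NN (Fs C : Finset (Finset (Sym2 V))) : Finset V :=
  Finset.univ.filter fun v => Q C v = 2 ∧ ∃ w, Q C w = 3 ∧ s(v, w) ∈ EE Fs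

/-- Boundary vertices of type two without an interior neighbour. -/
def HH (Fs C : Finset (Finset (Sym2 V))) : Finset V :=
  Finset.univ.filter fun v => Q C v = 2 ∧ ¬ ∃ w, Q C w = 3 ∧ s(v, w) ∈ EE Fs

/-- Number of vertices of type two. -/
def sg (C : Finset (Finset (Sym2 V))) : ℕ := (Finset.univ.filter fun v : V => Q C v = 2).card

theorem NH (Fs C : Finset (Finset (Sym2 V))) : (NN Fs C).card + (HH Fs C).card = sg C := by
  unfold NN HH sg
  rw [← Finset.card_filter_add_card_filter_not (s := Finset.univ.filter fun v : V => Q C v = 2)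
    (p := fun v => ∃ w, Q C w = 3 ∧ s(v, w) ∈ EE Fs), Finset.filter_filter, Finset.filter_filter]

theorem BB_sub (C : Finset (Finset (Sym2 V))) : BB C ⊆ C := Finset.filter_subset _ _

theorem KK_sub (C : Finset (Finset (Sym2 V))) : KK C ⊆ C := Finset.filter_subset _ _

theorem Ful.KB {Fs C : Finset (Finset (Sym2 V))} (h : Ful Fs) (hC : C ⊆ Fs) : KK C ⊆ BB C := by
  intro f hf
  unfold KK at hf
  unfold BB
  rw [Finset.mem_filter] at hf ⊢
  obtain ⟨v, hv⟩ := h.fne (hC hf.1)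
  exact ⟨hf.1, v, hv, hf.2 v hv⟩

/-- All faces at an interior vertex belong to `C`. -/
theorem Ful.inC {Fs C : Finset (Finset (Sym2 V))} (h : Ful Fs) (hC : C ⊆ Fs) {w : V}
    (hw : 3 ≤ Q C w) {f : Finset (Sym2 V)} (hf : f ∈ Fs) (hwf : w ∈ edgeVerts f) : f ∈ C := by
  have h1 := Q_sdiff hC w
  rw [h.Q3] at h1
  by_contra hfC
  have : 0 < Q (Fs \ C) w := Q_pos.2 ⟨f, Finset.mem_sdiff.2 ⟨hf, hfC⟩, hwf⟩
  omega

/-- A boundary vertex has a face outside `C`. -/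
theorem Ful.outC {Fs C : Finset (Finset (Sym2 V))} (h : Ful Fs) (hC : C ⊆ Fs) {w : V}
    (hw : Q C w ≤ 2) : ∃ g ∈ Fs \ C, w ∈ edgeVerts g := by
  have h1 := Q_sdiff hC w
  rw [h.Q3] at h1
  exact Q_pos.1 (by omega)

theorem mem_ev_left {f : Finset (Sym2 V)} {a b : V} (hab : s(a, b) ∈ f) : a ∈ edgeVerts f :=
  mem_ev.2 ⟨_, hab, by simp⟩

theorem mem_ev_right {f : Finset (Sym2 V)} {a b : V} (hab : s(a, b) ∈ f) : b ∈ edgeVerts f :=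
  mem_ev.2 ⟨_, hab, by simp⟩

theorem Ful.outC_Q {Fs C : Finset (Finset (Sym2 V))} (h : Ful Fs) (hC : C ⊆ Fs) {w : V}
    {g : Finset (Sym2 V)} (hg : g ∈ Fs \ C) (hwg : w ∈ edgeVerts g) : Q C w ≤ 2 := by
  by_contra hcon
  rw [Finset.mem_sdiff] at hg
  exact hg.2 (h.inC hC (by omega) hg.1 hwg)

theorem Ful.nbrI {Fs C : Finset (Finset (Sym2 V))} (h : Ful Fs) (hC : C ⊆ Fs) {v w : V}
    (hw : Q C w = 3) (hvw : s(v, w) ∈ EE Fs) : 2 ≤ Q C v := by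
  rw [← h.two _ hvw]
  apply Finset.card_le_card
  intro f hf
  rw [Finset.mem_filter] at hf ⊢
  exact ⟨h.inC hC hw.ge hf.1 (mem_ev_right hf.2), mem_ev_left hf.2⟩

/-- The two faces of `C` at a vertex of `NN` contain the interior edge. -/
theorem Ful.Nface {Fs C : Finset (Finset (Sym2 V))} (h : Ful Fs) (hC : C ⊆ Fs) {v w : V}
    (hv : Q C v = 2) (hw : Q C w = 3) (hvw : s(v, w) ∈ EE Fs) {f : Finset (Sym2 V)} (hf : f ∈ C)
    (hvf : v ∈ edgeVerts f) : s(v, w) ∈ f := by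
  have h1 : Fs.filter (fun f => s(v, w) ∈ f) ⊆ C.filter fun f => v ∈ edgeVerts f := by
    intro f hf
    rw [Finset.mem_filter] at hf ⊢
    exact ⟨h.inC hC hw.ge hf.1 (mem_ev_right hf.2), mem_ev_left hf.2⟩
  have h2 := Finset.eq_of_subset_of_card_le h1 (by
    rw [h.two _ hvw]
    exact hv.le)
  have h3 : f ∈ C.filter fun f => v ∈ edgeVerts f := Finset.mem_filter.2 ⟨hf, hvf⟩
  rw [← h2, Finset.mem_filter] at h3
  exact h3.2

theorem Ful.QK_N {Fs C : Finset (Finset (Sym2 V))} (h : Ful Fs) (hC : C ⊆ Fs) {v : V}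
    (hv : v ∈ NN Fs C) : Q (KK C) v = 0 := by
  unfold NN at hv
  rw [Finset.mem_filter] at hv
  obtain ⟨_, hv, w, hw, hvw⟩ := hv
  by_contra hcon
  obtain ⟨f, hf, hvf⟩ := Q_pos.1 (Nat.pos_of_ne_zero hcon)
  unfold KK at hf
  rw [Finset.mem_filter] at hf
  have := h.Nface hC hv hw hvw hf.1 hvf
  have := hf.2 w (mem_ev_right this)
  omega

theorem Ful.QK_I {Fs C : Finset (Finset (Sym2 V))} (_h : Ful Fs) {v : V}
    (hv : Q C v = 3) : Q (KK C) v = 0 := by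
  by_contra hcon
  obtain ⟨f, hf, hvf⟩ := Q_pos.1 (Nat.pos_of_ne_zero hcon)
  unfold KK at hf
  rw [Finset.mem_filter] at hf
  have := hf.2 v hvf
  omega

/-- A boundary vertex of a face in `C` has a boundary neighbour along the face. -/
theorem Ful.Unbr {Fs C : Finset (Finset (Sym2 V))} (h : Ful Fs) (hC : C ⊆ Fs) {v : V}
    (hv : Q C v ≤ 2) {f : Finset (Sym2 V)} (hf : f ∈ C) (hvf : v ∈ edgeVerts f) :
    ∃ w, s(v, w) ∈ f ∧ Q C w ≤ 2 := by
  obtain ⟨g, hg, hvg⟩ := h.outC hC hv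
  obtain ⟨e, hef, heg, hve⟩ := h.share (hC hf) (Finset.mem_sdiff.1 hg).1 hvf hvg
  obtain ⟨w, rfl⟩ := hve
  exact ⟨w, hef, h.outC_Q hC hg (mem_ev_right heg)⟩

theorem Ful.crossEnd {Fs C : Finset (Finset (Sym2 V))} (h : Ful Fs) (hC : C ⊆ Fs)
    {e : Sym2 V} (he : e ∈ EE Fs)
    (hc : ((Finset.univ.filter fun v : V => Q C v ≤ 2).filter fun v => v ∈ e).card = 1) :
    ∃ x y, e = s(x, y) ∧ Q C x = 2 ∧ Q C y = 3 := by
  have hnd := h.nd e he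
  have main : ∀ x y, s(x, y) ∈ EE Fs → Q C x ≤ 2 → ¬ Q C y ≤ 2 → Q C x = 2 ∧ Q C y = 3 := by
    intro x y hxy hx hy
    have := h.Qle hC y
    have hy3 : Q C y = 3 := by omega
    have := h.nbrI hC hy3 hxy
    omega
  induction e with
  | _ a b =>
    have hab : a ≠ b := by simpa using hnd
    by_cases ha : Q C a ≤ 2
    · by_cases hb : Q C b ≤ 2
      · exfalso
        have : ((Finset.univ.filter fun v : V => Q C v ≤ 2).filter fun v => v ∈ s(a, b)) =
            {a, b} := by
          ext v; simp only [Finset.mem_filter, Sym2.mem_iff, Finset.mem_insert,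
            Finset.mem_singleton, Finset.mem_univ, true_and]
          constructor
          · tauto
          · rintro (rfl | rfl) <;> simp [ha, hb]
        rw [this, Finset.card_pair hab] at hc
        omega
      · exact ⟨a, b, rfl, main a b he ha hb⟩
    · by_cases hb : Q C b ≤ 2
      · exact ⟨b, a, Sym2.eq_swap, main b a (by rw [Sym2.eq_swap]; exact he) hb ha⟩
      · exfalso
        have : ((Finset.univ.filter fun v : V => Q C v ≤ 2).filter fun v => v ∈ s(a, b)) =
            ∅ := by
          ext v; simp only [Finset.mem_filter, Sym2.mem_iff, Finset.mem_univ, true_and,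
            Finset.notMem_empty, iff_false]
          rintro ⟨hv, rfl | rfl⟩ <;> contradiction
        rw [this] at hc
        simp at hc

theorem Ful.twoN {Fs C : Finset (Finset (Sym2 V))} (h : Ful Fs) (hC : C ⊆ Fs)
    {f : Finset (Sym2 V)} (hf : f ∈ BB C \ KK C) :
    2 ≤ ((NN Fs C).filter fun v => v ∈ edgeVerts f).card := by
  unfold BB KK at hf
  simp only [Finset.mem_sdiff, Finset.mem_filter, not_and, not_forall] at hf
  obtain ⟨⟨hfC, a, ha, haU⟩, hb⟩ := hf
  obtain ⟨b, hb, hbU⟩ := hb hfC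
  have hfF := hC hfC
  have h1 := h.cross2 hfF (Finset.univ.filter fun v : V => Q C v ≤ 2) ha hb (by simpa using haU)
    (by simpa using hbU)
  obtain ⟨e1, he1, e2, he2, hne⟩ := Finset.one_lt_card.1 (lt_of_lt_of_le one_lt_two h1)
  rw [Finset.mem_filter] at he1 he2
  obtain ⟨x1, y1, rfl, hx1, hy1⟩ := h.crossEnd hC (mem_EE.2 ⟨f, hfF, he1.1⟩) he1.2
  obtain ⟨x2, y2, rfl, hx2, hy2⟩ := h.crossEnd hC (mem_EE.2 ⟨f, hfF, he2.1⟩) he2.2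
  have hN : ∀ x y, s(x, y) ∈ f → Q C x = 2 → Q C y = 3 →
      x ∈ (NN Fs C).filter fun v => v ∈ edgeVerts f := by
    intro x y hxy hx hy
    unfold NN
    simp only [Finset.mem_filter, Finset.mem_univ, true_and]
    exact ⟨⟨hx, y, hy, mem_EE.2 ⟨f, hfF, hxy⟩⟩, mem_ev_left hxy⟩
  apply Finset.one_lt_card.2
  refine ⟨x1, hN _ _ he1.1 hx1 hy1, x2, hN _ _ he2.1 hx2 hy2, ?_⟩
  rintro rfl
  obtain ⟨w, hw, hwU⟩ := h.Unbr hC hx1.le hfC (mem_ev_left he1.1)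
  have h2 := h.fdeg f hfF x1 (mem_ev_left hw)
  have h3 : ({s(x1, y1), s(x1, y2), s(x1, w)} : Finset (Sym2 V)) ⊆
      f.filter fun e => x1 ∈ e := by
    intro e he
    simp only [Finset.mem_insert, Finset.mem_singleton] at he
    rw [Finset.mem_filter]
    rcases he with rfl | rfl | rfl
    · exact ⟨he1.1, by simp⟩
    · exact ⟨he2.1, by simp⟩
    · exact ⟨hw, by simp⟩
  have h4 := Finset.card_le_card h3
  have h5 : ({s(x1, y1), s(x1, y2), s(x1, w)} : Finset (Sym2 V)).card = 3 := by
    rw [Finset.card_eq_three]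
    refine ⟨_, _, _, hne, ?_, ?_, rfl⟩
    · intro heq
      obtain rfl := Sym2.congr_right.1 heq
      omega
    · intro heq
      obtain rfl := Sym2.congr_right.1 heq
      omega
  unfold deg at h2
  omega

theorem Ful.step1 {Fs C : Finset (Finset (Sym2 V))} (h : Ful Fs) (hC : C ⊆ Fs) :
    (BB C \ KK C).card ≤ (NN Fs C).card := by
  have h1 := Finset.sum_card_bipartiteAbove_eq_sum_card_bipartiteBelow
    (s := BB C \ KK C) (t := NN Fs C) (fun f v => v ∈ edgeVerts f)
  simp only [Finset.bipartiteAbove, Finset.bipartiteBelow] at h1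
  have h2 := Finset.sum_le_sum (fun f hf => h.twoN hC (f := f) hf)
  have h3 : ∑ v ∈ NN Fs C, ((BB C \ KK C).filter fun f => v ∈ edgeVerts f).card ≤
      ∑ v ∈ NN Fs C, 2 := by
    apply Finset.sum_le_sum
    intro v hv
    unfold NN at hv
    rw [Finset.mem_filter] at hv
    rw [← hv.2.1]
    exact Q_mono (Finset.sdiff_subset.trans (BB_sub C)) v
  simp only [Finset.sum_const, smul_eq_mul] at h2 h3
  omega

theorem Ful.conn_sub {Fs C B : Finset (Finset (Sym2 V))} (h : Ful Fs) (hC : C ⊆ Fs)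
    (hc : Conn (Fs \ C)) (hB : B ⊆ BB C) : Conn (Fs \ (C \ B)) := by
  have heq : Fs \ (C \ B) = (Fs \ C) ∪ B := by
    ext f
    have h1 : f ∈ B → f ∈ Fs := fun hf => hC (BB_sub C (hB hf))
    simp only [Finset.mem_sdiff, Finset.mem_union]
    tauto
  rw [heq]
  apply h.conn_ext ((hB.trans (BB_sub C)).trans hC) hc
  intro f hf
  have := hB hf
  unfold BB at this
  rw [Finset.mem_filter] at this
  obtain ⟨_, v, hv, hvU⟩ := this
  exact ⟨v, hv, h.outC hC hvU⟩

theorem HH_card (Fs C : Finset (Finset (Sym2 V))) :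
    ((HH Fs C).card : ℤ) = ∑ v : V, if v ∈ HH Fs C then 1 else 0 := by
  simp

theorem Ful.step2 {Fs C : Finset (Finset (Sym2 V))} (h : Ful Fs) (hC : C ⊆ Fs)
    (hc : Conn (Fs \ C)) (hne : (C \ KK C).Nonempty) :
    6 * ((KK C).card : ℤ) ≤ XX C + 3 * (HH Fs C).card - 6 := by
  have h1 := h.key (C := C \ KK C) (Finset.sdiff_subset.trans hC) hne
    (h.conn_sub hC hc (h.KB hC))
  have h2 := pc_sdiff (KK_sub C)
  have h3 := h.sum_card ((KK_sub C).trans hC)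
  have h4 : ∀ v : V, (Q (KK C) v : ℤ) + ph (Q (C \ KK C) v) ≤
      ph (Q C v) + 3 * if v ∈ HH Fs C then 1 else 0 := by
    intro v
    have hle := h.Qle hC v
    have hs := Q_sdiff (KK_sub C) v
    by_cases hN : v ∈ NN Fs C
    · have hK := h.QK_N hC hN
      rw [hK] at hs ⊢
      rw [← hs]
      simp
      split_ifs <;> simp
    by_cases hI : Q C v = 3
    · have hK := h.QK_I hI
      rw [hK] at hs ⊢
      rw [← hs]
      simp
      split_ifs <;> simp
    by_cases hH : v ∈ HH Fs C
    · have hv2 : Q C v = 2 := by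
        unfold HH at hH
        exact (Finset.mem_filter.1 hH).2.1
      rw [if_pos hH]
      rw [hv2] at hs ⊢
      have : Q (KK C) v ≤ 2 := by omega
      generalize Q (KK C) v = a at *
      generalize Q (C \ KK C) v = b at *
      interval_cases a
      · obtain rfl : b = 2 := by omega
        decide
      · obtain rfl : b = 1 := by omega
        decide
      · obtain rfl : b = 0 := by omega
        decide
    · have hv2 : Q C v ≠ 2 := by
        intro hv2
        unfold HH at hH
        unfold NN at hN
        simp only [Finset.mem_filter, Finset.mem_univ, true_and, hv2] at hH hN
        exact hH hN
      have hv1 : Q C v ≤ 1 := by omega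
      rw [if_neg hH]
      rw [← hs] at hv1 ⊢
      generalize Q (KK C) v = a at *
      generalize Q (C \ KK C) v = b at *
      have ha : a ≤ 1 := by omega
      have hb : b ≤ 1 := by omega
      interval_cases a <;> interval_cases b <;> first | omega | decide
  have h5 := Finset.sum_le_sum (s := (Finset.univ : Finset V)) (fun v _ => h4 v)
  rw [Finset.sum_add_distrib, Finset.sum_add_distrib, ← Finset.mul_sum, ← HH_card, h3] at h5
  unfold XX at h1 ⊢
  omega

/-- Number of pentagons plus number of boundary vertices. -/
def Om (C : Finset (Finset (Sym2 V))) : ℤ :=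
  pc C + ∑ v : V, if Q C v = 1 ∨ Q C v = 2 then 1 else 0

theorem sg_sum (C : Finset (Finset (Sym2 V))) :
    (sg C : ℤ) = ∑ v : V, if Q C v = 2 then 1 else 0 := by
  simp [sg]

theorem Om_eq (C : Finset (Finset (Sym2 V))) : Om C = 2 * sg C + XX C := by
  unfold Om XX
  rw [sg_sum, Finset.mul_sum]
  have : ∀ v : V, (if Q C v = 1 ∨ Q C v = 2 then (1 : ℤ) else 0) =
      2 * (if Q C v = 2 then 1 else 0) + ph (Q C v) := by
    intro v
    unfold ph
    by_cases h1 : Q C v = 1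
    · simp [h1]
    · by_cases h2 : Q C v = 2
      · simp [h2]
      · simp [h1, h2]
  rw [Finset.sum_congr rfl (fun v _ => this v), Finset.sum_add_distrib]
  ring

theorem Ful.two_edges {Fs : Finset (Finset (Sym2 V))} (h : Ful Fs) {w : V} {e1 e2 : Sym2 V}
    (he1 : e1 ∈ EE Fs) (he2 : e2 ∈ EE Fs) (hw1 : w ∈ e1) (hw2 : w ∈ e2) (hne : e1 ≠ e2)
    {f : Finset (Sym2 V)} (hf : f ∈ Fs) (hwf : w ∈ edgeVerts f) : e1 ∈ f ∨ e2 ∈ f := by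
  by_contra hcon
  push Not at hcon
  have h1 := h.fdeg f hf w hwf
  have h2 := h.cub w
  unfold deg at h1 h2
  have h3 : insert e1 (insert e2 (f.filter fun e => w ∈ e)) ⊆ (EE Fs).filter fun e => w ∈ e := by
    intro e he
    simp only [Finset.mem_insert, Finset.mem_filter] at he ⊢
    rcases he with rfl | rfl | he
    · exact ⟨he1, hw1⟩
    · exact ⟨he2, hw2⟩
    · exact ⟨mem_EE.2 ⟨f, hf, he.1⟩, he.2⟩
  have h4 := Finset.card_le_card h3
  rw [Finset.card_insert_of_notMem, Finset.card_insert_of_notMem] at h4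
  · omega
  · simp [hcon.2]
  · simp [hcon.1, hne]

/-- Number of `NN`-neighbours. -/
def tt (Fs C : Finset (Finset (Sym2 V))) (w : V) : ℕ :=
  ((NN Fs C).filter fun v => s(v, w) ∈ EE Fs).card

theorem Ful.tt_le {Fs C : Finset (Finset (Sym2 V))} (h : Ful Fs) (hC : C ⊆ Fs) {w : V}
    (hw : Q C w = 3) :
    tt Fs C w + (if Q (C \ BB C) w = 1 ∨ Q (C \ BB C) w = 2 then 1 else 0) ≤ Q (BB C) w := by
  have hs := Q_sdiff (BB_sub C) w
  rw [hw] at hs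
  have inB : ∀ v f, v ∈ NN Fs C → f ∈ Fs → s(v, w) ∈ f → f ∈ BB C := by
    intro v f hv hf hvw
    unfold NN at hv
    rw [Finset.mem_filter] at hv
    unfold BB
    rw [Finset.mem_filter]
    exact ⟨h.inC hC hw.ge hf (mem_ev_right hvw), v, mem_ev_left hvw, hv.2.1.le⟩
  have t3 : tt Fs C w ≤ 3 := by
    rw [← h.cub w]
    unfold tt deg
    apply Finset.card_le_card_of_injOn (fun v => s(v, w))
    · intro v hv
      simp only [Finset.coe_filter, Set.mem_ofPred_eq] at hv ⊢
      exact ⟨hv.2, by simp⟩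
    · intro a _ b _ hab
      exact Sym2.congr_left.1 hab
  have t1 : 0 < tt Fs C w → 2 ≤ Q (BB C) w := by
    intro ht
    unfold tt at ht
    rw [Finset.card_pos] at ht
    obtain ⟨v, hv⟩ := ht
    rw [Finset.mem_filter] at hv
    rw [← h.two _ hv.2]
    apply Finset.card_le_card
    intro f hf
    rw [Finset.mem_filter] at hf ⊢
    exact ⟨inB v f hv.1 hf.1 hf.2, mem_ev_right hf.2⟩
  have t2 : 1 < tt Fs C w → 3 ≤ Q (BB C) w := by
    intro ht
    unfold tt at ht
    obtain ⟨a, ha, b, hb, hne⟩ := Finset.one_lt_card.1 ht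
    rw [Finset.mem_filter] at ha hb
    rw [← h.Q3 w]
    apply Finset.card_le_card
    intro f hf
    rw [Finset.mem_filter] at hf ⊢
    refine ⟨?_, hf.2⟩
    rcases h.two_edges ha.2 hb.2 (w := w) (by simp) (by simp)
      (fun heq => hne (Sym2.congr_left.1 heq)) hf.1 hf.2 with h1 | h1
    · exact inB a f ha.1 hf.1 h1
    · exact inB b f hb.1 hf.1 h1
  split_ifs with hi <;> omega

theorem Ful.step3 {Fs C : Finset (Finset (Sym2 V))} (h : Ful Fs) (hC : C ⊆ Fs) :
    Om (C \ BB C) + Om C + 2 * (sg C : ℤ) - (HH Fs C).card ≤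
      6 * ((BB C).card : ℤ) + 2 * pc (C \ BB C) := by
  have h1 := h.sum_card ((BB_sub C).trans hC)
  have h2 := pc_sdiff (BB_sub C)
  have h3 := NH Fs C
  have hN : (NN Fs C).card ≤ ∑ w : V, if Q C w = 3 then tt Fs C w else 0 := by
    have h4 := Finset.sum_card_bipartiteAbove_eq_sum_card_bipartiteBelow
      (s := NN Fs C) (t := Finset.univ.filter fun w => Q C w = 3) (fun v w => s(v, w) ∈ EE Fs)
    simp only [Finset.bipartiteAbove, Finset.bipartiteBelow] at h4
    rw [← Finset.sum_filter]
    unfold tt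
    rw [← h4, Finset.card_eq_sum_ones]
    apply Finset.sum_le_sum
    intro v hv
    unfold NN at hv
    rw [Finset.mem_filter] at hv
    obtain ⟨_, _, w, hw, hvw⟩ := hv
    rw [Nat.succ_le_iff, Finset.card_pos]
    exact ⟨w, by simp [hw, hvw]⟩
  have h5 : ∀ v : V, (if Q (C \ BB C) v = 1 ∨ Q (C \ BB C) v = 2 then (1 : ℤ) else 0) +
      (if Q C v = 1 ∨ Q C v = 2 then (1 : ℤ) else 0) + (if Q C v = 2 then 1 else 0) +
      ((if Q C v = 3 then tt Fs C v else 0 : ℕ) : ℤ) ≤ Q (BB C) v := by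
    intro v
    have hle := h.Qle hC v
    have hs := Q_sdiff (BB_sub C) v
    by_cases hI : Q C v = 3
    · have := h.tt_le hC hI
      simp only [hI]
      simp
      split_ifs at this ⊢ <;> omega
    · have h0 : Q (C \ BB C) v = 0 := by
        by_contra hcon
        obtain ⟨f, hf, hvf⟩ := Q_pos.1 (Nat.pos_of_ne_zero hcon)
        rw [Finset.mem_sdiff] at hf
        apply hf.2
        unfold BB
        rw [Finset.mem_filter]
        exact ⟨hf.1, v, hvf, by omega⟩
      rw [h0] at hs ⊢
      simp only [hI]
      simp
      split_ifs <;> omega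
  have h6 := Finset.sum_le_sum (s := (Finset.univ : Finset V)) (fun v _ => h5 v)
  rw [Finset.sum_add_distrib, Finset.sum_add_distrib, Finset.sum_add_distrib, ← sg_sum, h1,
    ← Nat.cast_sum] at h6
  unfold Om
  generalize (∑ w : V, if Q C w = 3 then tt Fs C w else 0) = T at *
  omega

theorem BK_card {C : Finset (Finset (Sym2 V))} (h : KK C ⊆ BB C) :
    (BB C).card = (BB C \ KK C).card + (KK C).card :=
  (Finset.card_sdiff_add_card_eq_card h).symm

theorem Ful.step4B {Fs C : Finset (Finset (Sym2 V))} (h : Ful Fs) (hC : C ⊆ Fs)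
    (hc : Conn (Fs \ C)) (hne : (C \ KK C).Nonempty) :
    6 * ((BB C).card : ℤ) ≤ 6 * sg C - 3 * (HH Fs C).card + XX C - 6 := by
  have h1 := h.step1 hC
  have h2 := h.step2 hC hc hne
  have h3 := NH Fs C
  have h4 := BK_card (h.KB hC)
  omega

theorem Ful.Knonempty {Fs C : Finset (Finset (Sym2 V))} (h : Ful Fs) (hC : C ⊆ Fs)
    (hne : (C \ BB C).Nonempty) : (C \ KK C).Nonempty :=
  hne.mono (Finset.sdiff_subset_sdiff le_rfl (h.KB hC))

theorem Ful.step4 {Fs C : Finset (Finset (Sym2 V))} (h : Ful Fs) (hC : C ⊆ Fs)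
    (hc : Conn (Fs \ C)) (hne : (C \ BB C).Nonempty) :
    Om (C \ BB C) ≤ Om C + 2 * pc C - 12 := by
  have h1 := h.step4B hC hc (h.Knonempty hC hne)
  have h2 := h.step3 hC
  have h3 := Om_eq C
  have h4 := h.key hC (hne.mono Finset.sdiff_subset) hc
  have h5 := pc_sdiff (BB_sub C)
  omega

theorem Ful.step5 {Fs C : Finset (Finset (Sym2 V))} (h : Ful Fs) (hC : C ⊆ Fs)
    (hc : Conn (Fs \ C)) (hne : C.Nonempty) (hK : C \ KK C = ∅) :
    4 * (C.card : ℤ) ≤ Om C - 2 := by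
  have hKC : KK C = C :=
    Finset.Subset.antisymm (KK_sub C) (Finset.sdiff_eq_empty_iff_subset.1 hK)
  have h1 := h.sum_card hC
  have h2 := h.key hC hne hc
  have h3 := Om_eq C
  have h4 : ∀ v : V, (Q C v : ℤ) = (if Q C v = 1 ∨ Q C v = 2 then 1 else 0) +
      (if Q C v = 2 then 1 else 0) := by
    intro v
    have hle := h.Qle hC v
    have : Q C v ≠ 3 := by
      intro hv
      have := h.QK_I hv
      rw [hKC] at this
      omega
    split_ifs <;> omega
  rw [Finset.sum_congr rfl (fun v _ => h4 v), Finset.sum_add_distrib, ← sg_sum] at h1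
  have h5 : Om C = pc C + ∑ v : V, if Q C v = 1 ∨ Q C v = 2 then 1 else 0 := rfl
  omega

theorem Ful.split {Fs C : Finset (Finset (Sym2 V))} (h : Ful Fs) (hC : C ⊆ Fs)
    (hc : Conn (Fs \ C)) (hne : C.Nonempty) :
    4 * (C.card : ℤ) ≤ Om C - 2 ∨ 2 * (C.card : ℤ) ≤ Om C - 6 ∨
    ((C \ BB C).Nonempty ∧ 2 * (C.card : ℤ) ≤ Om C - 6 + 2 * (C \ BB C).card ∧
      Om (C \ BB C) ≤ Om C + 2 * pc C - 12) := by
  by_cases hK : C \ KK C = ∅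
  · exact Or.inl (h.step5 hC hc hne hK)
  · right
    rw [← ne_eq, ← Finset.nonempty_iff_ne_empty] at hK
    have h1 := h.step4B hC hc hK
    have h2 := h.key hC hne hc
    have h3 := Om_eq C
    have h4 := Finset.card_sdiff_add_card_eq_card (BB_sub C)
    by_cases hB : C \ BB C = ∅
    · left
      rw [hB] at h4
      simp at h4
      omega
    · right
      rw [← ne_eq, ← Finset.nonempty_iff_ne_empty] at hB
      have h5 := h.step4 hC hc hB
      refine ⟨hB, ?_, h5⟩
      omega

theorem Ful.ind {Fs : Finset (Finset (Sym2 V))} (h : Ful Fs) (w : ℕ) :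
    ∀ C : Finset (Finset (Sym2 V)), C ⊆ Fs → Conn (Fs \ C) → pc C ≤ 5 → Om C ≤ 2 * w + 6 →
      2 * C.card ≤ 2 + w * (w + 1) := by
  induction w with
  | zero =>
    intro C hC hc hp hO
    by_cases hne : C.Nonempty
    swap
    · rw [Finset.not_nonempty_iff_eq_empty] at hne
      simp [hne]
    rcases h.split hC hc hne with h1 | h1 | ⟨hB, h1, h2⟩
    · simp at hO ⊢; omega
    · simp at hO ⊢; omega
    · exfalso
      have h3 := h.key (Finset.sdiff_subset.trans hC) hB (h.conn_sub hC hc le_rfl)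
      have h4 := Om_eq (C \ BB C)
      push_cast at hO
      omega
  | succ w ih =>
    intro C hC hc hp hO
    by_cases hne : C.Nonempty
    swap
    · rw [Finset.not_nonempty_iff_eq_empty] at hne
      simp [hne]
    have hq : (w + 1) * (w + 1 + 1) = w * (w + 1) + 2 * w + 2 := by ring
    rw [hq]
    generalize w * (w + 1) = z at *
    push_cast at hO
    rcases h.split hC hc hne with h1 | h1 | ⟨hB, h1, h2⟩
    · omega
    · omega
    · have h3 := ih (C \ BB C) (Finset.sdiff_subset.trans hC) (h.conn_sub hC hc le_rfl)
        (by have := pc_sdiff (BB_sub C); omega) (by omega)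
      omega

theorem Ful.three_faces {Fs : Finset (Finset (Sym2 V))} (h : Ful Fs) {e : Sym2 V}
    {f g g' : Finset (Sym2 V)} (hf : f ∈ Fs) (hg : g ∈ Fs) (hg' : g' ∈ Fs)
    (he : e ∈ f) (heg : e ∈ g) (heg' : e ∈ g') (h1 : f ≠ g) (h2 : f ≠ g') (h3 : g ≠ g') :
    False := by
  have h5 : ({f, g, g'} : Finset (Finset (Sym2 V))) ⊆ Fs.filter fun f => e ∈ f := by
    intro x hx
    simp only [Finset.mem_insert, Finset.mem_singleton] at hx
    rw [Finset.mem_filter]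
    rcases hx with rfl | rfl | rfl
    · exact ⟨hf, he⟩
    · exact ⟨hg, heg⟩
    · exact ⟨hg', heg'⟩
  have h4 := Finset.card_le_card h5
  have h6 : ({f, g, g'} : Finset (Finset (Sym2 V))).card = 3 := by
    rw [Finset.card_eq_three]
    exact ⟨f, g, g', h1, h2, h3, rfl⟩
  have := h.two e (mem_EE.2 ⟨f, hf, he⟩)
  omega

theorem Ful.deg_inter {Fs : Finset (Finset (Sym2 V))} (h : Ful Fs) {f g : Finset (Sym2 V)}
    (hf : f ∈ Fs) (hg : g ∈ Fs) (hfg : f ≠ g) {v : V} (hvf : v ∈ edgeVerts f)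
    (hvg : v ∈ edgeVerts g) : deg (f ∩ g) v = 1 := by
  obtain ⟨e, hef, heg, hve⟩ := h.share hf hg hvf hvg
  unfold deg
  rw [Finset.card_eq_one]
  refine ⟨e, ?_⟩
  ext e'
  simp only [Finset.mem_filter, Finset.mem_inter, Finset.mem_singleton]
  constructor
  · rintro ⟨⟨hef', heg'⟩, hve'⟩
    by_contra hne
    have h3 := h.Q3 v
    unfold Q at h3
    have : ∃ x ∈ Fs.filter (fun f => v ∈ edgeVerts f), x ∉ ({f, g} : Finset _) := by
      apply Finset.exists_mem_notMem_of_card_lt_card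
      rw [h3, Finset.card_pair hfg]
      omega
    obtain ⟨x, hx, hxn⟩ := this
    rw [Finset.mem_filter] at hx
    simp only [Finset.mem_insert, Finset.mem_singleton, not_or] at hxn
    rcases h.two_edges (mem_EE.2 ⟨f, hf, hef⟩) (mem_EE.2 ⟨f, hf, hef'⟩) hve hve'
      (fun h => hne h.symm) hx.1 hx.2 with h4 | h4
    · exact h.three_faces hx.1 hf hg h4 hef heg hxn.1 hxn.2 hfg
    · exact h.three_faces hx.1 hf hg h4 hef' heg' hxn.1 hxn.2 hfg
  · rintro rfl
    exact ⟨⟨hef, heg⟩, hve⟩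

theorem Ful.inter_card {Fs : Finset (Finset (Sym2 V))} (h : Ful Fs) {f g : Finset (Sym2 V)}
    (hf : f ∈ Fs) (hg : g ∈ Fs) (hfg : f ≠ g) :
    (edgeVerts f ∩ edgeVerts g).card = 2 * (f ∩ g).card := by
  rw [← deg_total _ (fun e he => h.fnd hf e (Finset.mem_inter.1 he).1), Finset.card_eq_sum_ones]
  rw [← Finset.sum_subset (Finset.subset_univ (edgeVerts f ∩ edgeVerts g))]
  · apply Finset.sum_congr rfl
    intro v hv
    rw [Finset.mem_inter] at hv
    exact (h.deg_inter hf hg hfg hv.1 hv.2).symm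
  · intro v _ hv
    apply deg_zero
    intro hc
    obtain ⟨e, he, hve⟩ := mem_ev.1 hc
    rw [Finset.mem_inter] at he
    exact hv (Finset.mem_inter.2 ⟨mem_ev.2 ⟨e, he.1, hve⟩, mem_ev.2 ⟨e, he.2, hve⟩⟩)

/-- Abstract pentagonal ring. -/
structure Rg (Fs : Finset (Finset (Sym2 V))) (k : ℕ) (R : ZMod k → Finset (Sym2 V)) : Prop where
  inj : Function.Injective R
  face : ∀ i, R i ∈ Fs
  five : ∀ i, (R i).card = 5
  meet : ∀ i j : ZMod k, i ≠ j →
    ((edgeVerts (R i) ∩ edgeVerts (R j)).Nonempty ↔ (j = i + 1 ∨ i = j + 1))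

theorem zne {k : ℕ} (hk : 7 ≤ k) (m : ℕ) (h0 : 0 < m) (h7 : m < 7) : (m : ZMod k) ≠ 0 := by
  intro h
  rw [ZMod.natCast_eq_zero_iff] at h
  have := Nat.le_of_dvd h0 h
  omega

theorem zne1 {k : ℕ} (hk : 7 ≤ k) : (1 : ZMod k) ≠ 0 := by
  simpa using zne hk 1 (by omega) (by omega)

theorem zne2 {k : ℕ} (hk : 7 ≤ k) : (2 : ZMod k) ≠ 0 := by
  simpa using zne hk 2 (by omega) (by omega)

theorem zne3 {k : ℕ} (hk : 7 ≤ k) : (3 : ZMod k) ≠ 0 := by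
  simpa using zne hk 3 (by omega) (by omega)

theorem Rg.nb {Fs : Finset (Finset (Sym2 V))} {k : ℕ} {R : ZMod k → Finset (Sym2 V)}
    (r : Rg Fs k R) {i j : ZMod k} (hij : i ≠ j) {v : V} (hi : v ∈ edgeVerts (R i))
    (hj : v ∈ edgeVerts (R j)) : j = i + 1 ∨ i = j + 1 :=
  (r.meet i j hij).1 ⟨v, Finset.mem_inter.2 ⟨hi, hj⟩⟩

theorem Rg.no3 {Fs : Finset (Finset (Sym2 V))} {k : ℕ} {R : ZMod k → Finset (Sym2 V)}
    (r : Rg Fs k R) (hk : 7 ≤ k) {i j l : ZMod k} (hij : i ≠ j) (hil : i ≠ l) (hjl : j ≠ l)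
    {v : V} (hi : v ∈ edgeVerts (R i))
    (hj : v ∈ edgeVerts (R j)) (hl : v ∈ edgeVerts (R l)) : False := by
  have h1 := r.nb hij hi hj
  have h2 := r.nb hil hi hl
  have h3 := r.nb hjl hj hl
  have z1 := zne1 hk
  have z3 := zne3 hk
  rcases h1 with h1 | h1 <;> rcases h2 with h2 | h2 <;> rcases h3 with h3 | h3
  · exact hjl (by rw [h1, h2])
  · exact hjl (by rw [h1, h2])
  · exact z3 (by linear_combination -h1 - h2 - h3)
  · exact z1 (by linear_combination -h1 - h2 + h3)
  · exact z1 (by linear_combination -h1 - h2 + h3)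
  · exact z3 (by linear_combination -h1 - h2 - h3)
  · exact hjl (by linear_combination h2 - h1)
  · exact hjl (by linear_combination h2 - h1)

/-- The set of ring faces. -/
def AA {k : ℕ} [NeZero k] (R : ZMod k → Finset (Sym2 V)) : Finset (Finset (Sym2 V)) :=
  Finset.univ.image R

theorem mem_AA {k : ℕ} [NeZero k] {R : ZMod k → Finset (Sym2 V)} {f : Finset (Sym2 V)} :
    f ∈ AA R ↔ ∃ i, R i = f := by
  simp [AA]

theorem Rg.sub {Fs : Finset (Finset (Sym2 V))} {k : ℕ} [NeZero k]
    {R : ZMod k → Finset (Sym2 V)} (r : Rg Fs k R) : AA R ⊆ Fs := by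
  intro f hf
  obtain ⟨i, rfl⟩ := mem_AA.1 hf
  exact r.face i

theorem Rg.card {Fs : Finset (Finset (Sym2 V))} {k : ℕ} [NeZero k]
    {R : ZMod k → Finset (Sym2 V)} (r : Rg Fs k R) : (AA R).card = k := by
  unfold AA
  rw [Finset.card_image_of_injective _ r.inj, Finset.card_univ, ZMod.card]

theorem Rg.pc {Fs : Finset (Finset (Sym2 V))} {k : ℕ} [NeZero k]
    {R : ZMod k → Finset (Sym2 V)} (r : Rg Fs k R) : pc (AA R) = k := by
  unfold FG.pc
  rw [Finset.filter_true_of_mem, r.card]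
  intro f hf
  obtain ⟨i, rfl⟩ := mem_AA.1 hf
  exact r.five i

theorem Rg.Q2 {Fs : Finset (Finset (Sym2 V))} {k : ℕ} [NeZero k]
    {R : ZMod k → Finset (Sym2 V)} (r : Rg Fs k R) (hk : 7 ≤ k) (v : V) : Q (AA R) v ≤ 2 := by
  by_contra hcon
  push Not at hcon
  unfold Q at hcon
  obtain ⟨a, b, c, ha, hb, hc, hab, hac, hbc⟩ := Finset.two_lt_card_iff.1 hcon
  rw [Finset.mem_filter, mem_AA] at ha hb hc
  obtain ⟨⟨i, rfl⟩, hi⟩ := ha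
  obtain ⟨⟨j, rfl⟩, hj⟩ := hb
  obtain ⟨⟨l, rfl⟩, hl⟩ := hc
  exact r.no3 hk (fun h => hab (by rw [h])) (fun h => hac (by rw [h]))
    (fun h => hbc (by rw [h])) hi hj hl

theorem Rg.inter2 {Fs : Finset (Finset (Sym2 V))} {k : ℕ} [NeZero k]
    {R : ZMod k → Finset (Sym2 V)} (r : Rg Fs k R) (h : Ful Fs) (hk : 7 ≤ k) (i : ZMod k) :
    (edgeVerts (R i) ∩ edgeVerts (R (i + 1))).card = 2 ∧
    (edgeVerts (R i) ∩ edgeVerts (R (i - 1))).card = 2 := by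
  have z1 := zne1 hk
  have z2 := zne2 hk
  have n1 : i ≠ i + 1 := by intro hc; exact z1 (by linear_combination -hc)
  have n2 : i ≠ i - 1 := by intro hc; exact z1 (by linear_combination hc)
  have n3 : i + 1 ≠ i - 1 := by intro hc; exact z2 (by linear_combination hc)
  have c1 := h.inter_card (r.face i) (r.face (i + 1)) (fun hc => n1 (r.inj hc))
  have c2 := h.inter_card (r.face i) (r.face (i - 1)) (fun hc => n2 (r.inj hc))
  have p1 := Finset.card_pos.2 ((r.meet i (i + 1) n1).2 (Or.inl rfl))
  have p2 := Finset.card_pos.2 ((r.meet i (i - 1) n2).2 (Or.inr (by ring)))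
  have hd : Disjoint (edgeVerts (R i) ∩ edgeVerts (R (i + 1)))
      (edgeVerts (R i) ∩ edgeVerts (R (i - 1))) := by
    rw [Finset.disjoint_left]
    intro v hv hv'
    rw [Finset.mem_inter] at hv hv'
    exact r.no3 hk n1 n2 n3 hv.1 hv.2 hv'.2
  have h3 := Finset.card_union_of_disjoint hd
  have h4 : (edgeVerts (R i) ∩ edgeVerts (R (i + 1))) ∪
      (edgeVerts (R i) ∩ edgeVerts (R (i - 1))) ⊆ edgeVerts (R i) :=
    Finset.union_subset Finset.inter_subset_left Finset.inter_subset_left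
  have h5 := Finset.card_le_card h4
  rw [h.cardv (r.face i), r.five i] at h5
  omega

theorem Rg.face4 {Fs : Finset (Finset (Sym2 V))} {k : ℕ} [NeZero k]
    {R : ZMod k → Finset (Sym2 V)} (r : Rg Fs k R) (h : Ful Fs) (hk : 7 ≤ k) (i : ZMod k) :
    ((Finset.univ.filter fun v : V => Q (AA R) v = 2).filter
      fun v => v ∈ edgeVerts (R i)).card = 4 := by
  have z1 := zne1 hk
  have z2 := zne2 hk
  have n1 : i ≠ i + 1 := by intro hc; exact z1 (by linear_combination -hc)
  have n2 : i ≠ i - 1 := by intro hc; exact z1 (by linear_combination hc)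
  have n3 : i + 1 ≠ i - 1 := by intro hc; exact z2 (by linear_combination hc)
  have hd : Disjoint (edgeVerts (R i) ∩ edgeVerts (R (i + 1)))
      (edgeVerts (R i) ∩ edgeVerts (R (i - 1))) := by
    rw [Finset.disjoint_left]
    intro v hv hv'
    rw [Finset.mem_inter] at hv hv'
    exact r.no3 hk n1 n2 n3 hv.1 hv.2 hv'.2
  obtain ⟨h1, h2⟩ := r.inter2 h hk i
  have h3 := Finset.card_union_of_disjoint hd
  rw [h1, h2] at h3
  refine Eq.trans ?_ h3
  congr 1
  have key : ∀ v j, i ≠ j → v ∈ edgeVerts (R i) → v ∈ edgeVerts (R j) → Q (AA R) v = 2 := by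
    intro v j hij hi hj
    have h4 := r.Q2 hk v
    have h5 : 1 < Q (AA R) v := by
      unfold Q
      rw [Finset.one_lt_card]
      exact ⟨R i, Finset.mem_filter.2 ⟨mem_AA.2 ⟨i, rfl⟩, hi⟩, R j,
        Finset.mem_filter.2 ⟨mem_AA.2 ⟨j, rfl⟩, hj⟩, fun hc => hij (r.inj hc)⟩
    omega
  ext v
  simp only [Finset.mem_filter, Finset.mem_univ, true_and, Finset.mem_union, Finset.mem_inter]
  constructor
  · rintro ⟨hq, hi⟩
    have h5 : 1 < Q (AA R) v := by omega
    unfold Q at h5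
    obtain ⟨g, hg, hne⟩ := Finset.exists_mem_ne h5 (R i)
    rw [Finset.mem_filter, mem_AA] at hg
    obtain ⟨⟨j, rfl⟩, hj⟩ := hg
    have hij : i ≠ j := fun hc => hne (by rw [hc])
    rcases r.nb hij hi hj with rfl | rfl
    · exact Or.inl ⟨hi, hj⟩
    · exact Or.inr ⟨hi, by simpa using hj⟩
  · rintro (⟨hi, hj⟩ | ⟨hi, hj⟩)
    · exact ⟨key v _ n1 hi hj, hi⟩
    · exact ⟨key v _ n2 hi hj, hi⟩

theorem Rg.n2 {Fs : Finset (Finset (Sym2 V))} {k : ℕ} [NeZero k]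
    {R : ZMod k → Finset (Sym2 V)} (r : Rg Fs k R) (h : Ful Fs) (hk : 7 ≤ k) :
    sg (AA R) = 2 * k := by
  have h1 := Finset.sum_card_bipartiteAbove_eq_sum_card_bipartiteBelow
    (s := AA R) (t := Finset.univ.filter fun v : V => Q (AA R) v = 2) (fun f v => v ∈ edgeVerts f)
  simp only [Finset.bipartiteAbove, Finset.bipartiteBelow] at h1
  have h2 : ∀ f ∈ AA R, ((Finset.univ.filter fun v : V => Q (AA R) v = 2).filter
      fun v => v ∈ edgeVerts f).card = 4 := by
    intro f hf
    obtain ⟨i, rfl⟩ := mem_AA.1 hf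
    exact r.face4 h hk i
  rw [Finset.sum_congr rfl h2] at h1
  have h3 : ∀ v ∈ (Finset.univ.filter fun v : V => Q (AA R) v = 2),
      ((AA R).filter fun f => v ∈ edgeVerts f).card = 2 := by
    intro v hv
    exact (Finset.mem_filter.1 hv).2
  rw [Finset.sum_congr rfl h3] at h1
  simp only [Finset.sum_const, smul_eq_mul, r.card] at h1
  unfold sg
  omega

theorem Rg.XC {Fs : Finset (Finset (Sym2 V))} {k : ℕ} [NeZero k]
    {R : ZMod k → Finset (Sym2 V)} (r : Rg Fs k R) (h : Ful Fs) (hk : 7 ≤ k) :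
    XX (Fs \ AA R) = 12 ∧ sg (Fs \ AA R) = k := by
  have h1 := h.sum_card r.sub
  rw [r.pc, r.card] at h1
  have h2 := r.n2 h hk
  have h3 := sg_sum (AA R)
  have h4 := h.XX_compl r.sub
  constructor
  · have h5 : XX (AA R) = 0 := by
      unfold XX
      have : ∀ v : V, ph (Q (AA R) v) = Q (AA R) v - 3 * (if Q (AA R) v = 2 then 1 else 0) := by
        intro v
        have := r.Q2 hk v
        generalize Q (AA R) v = q at *
        interval_cases q <;> decide
      rw [Finset.sum_congr rfl (fun v _ => this v), Finset.sum_sub_distrib, ← Finset.mul_sum,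
        ← h3, h1, r.pc, h2]
      push_cast
      ring
    omega
  · have h5 := sg_sum (Fs \ AA R)
    have : ∀ v : V, (if Q (Fs \ AA R) v = 2 then 1 else 0 : ℤ) =
        Q (AA R) v - 2 * (if Q (AA R) v = 2 then 1 else 0) := by
      intro v
      have h6 := r.Q2 hk v
      have h7 := Q_sdiff r.sub v
      rw [h.Q3] at h7
      split_ifs <;> omega
    rw [Finset.sum_congr rfl (fun v _ => this v), Finset.sum_sub_distrib, ← Finset.mul_sum,
        ← h3, h1, h2] at h5
    push_cast at h5
    omega

theorem Rg.conn {Fs : Finset (Finset (Sym2 V))} {k : ℕ} [NeZero k]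
    {R : ZMod k → Finset (Sym2 V)} (r : Rg Fs k R) (h : Ful Fs) (hk : 7 ≤ k) :
    Conn (AA R) := by
  have z1 := zne1 hk
  have key : ∀ m : ℕ, Conn ((Finset.range (m + 1)).image fun j : ℕ => R (j : ZMod k)) := by
    intro m
    induction m with
    | zero =>
      intro a ha b hb
      rw [mem_evEE] at ha hb
      obtain ⟨f, hf, haf⟩ := ha
      obtain ⟨g, hg, hbg⟩ := hb
      simp at hf hg
      subst hf
      subst hg
      refine h.face_reach (r.face 0) (e := s(a, a)) ?_ a haf b hbg
      intro x y hxy _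
      exact reach_edge (mem_EE.2 ⟨R 0, by simp, hxy⟩)
    | succ m ih =>
      have heq : ((Finset.range (m + 1 + 1)).image fun j : ℕ => R (j : ZMod k)) =
          ((Finset.range (m + 1)).image fun j : ℕ => R (j : ZMod k)) ∪
            {R ((m + 1 : ℕ) : ZMod k)} := by
        rw [Finset.range_add_one, Finset.image_insert, Finset.insert_eq, Finset.union_comm]
      rw [heq]
      apply h.conn_ext (Finset.singleton_subset_iff.2 (r.face _)) ih
      intro f hf
      rw [Finset.mem_singleton] at hf
      subst hf
      obtain ⟨v, hv⟩ := (r.meet ((m : ℕ) : ZMod k) ((m + 1 : ℕ) : ZMod k) (by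
        intro hc
        push_cast at hc
        exact z1 (by linear_combination -hc))).2 (Or.inl (by push_cast; rfl))
      rw [Finset.mem_inter] at hv
      exact ⟨v, hv.2, R (m : ZMod k), Finset.mem_image.2 ⟨m, by simp, rfl⟩, hv.1⟩
  have : AA R = (Finset.range (k - 1 + 1)).image fun j : ℕ => R (j : ZMod k) := by
    ext f
    rw [mem_AA, Finset.mem_image]
    constructor
    · rintro ⟨i, rfl⟩
      refine ⟨i.val, ?_, by simp⟩
      have := ZMod.val_lt i
      rw [Finset.mem_range]
      omega
    · rintro ⟨j, _, rfl⟩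
      exact ⟨_, rfl⟩
  rw [this]
  exact key _

/-- Around an edge of `f` on a ring face. -/
theorem Rg.other {Fs : Finset (Finset (Sym2 V))} {k : ℕ} [NeZero k]
    {R : ZMod k → Finset (Sym2 V)} (r : Rg Fs k R) (h : Ful Fs)
    {f : Finset (Sym2 V)} (hf : f ∈ Fs \ AA R) (hall : f ⊆ EE (AA R)) {i : ZMod k} {u v : V}
    (huf : s(u, v) ∈ f) (hui : s(u, v) ∈ R i) :
    ∃ j, (j = i + 1 ∨ i = j + 1) ∧ u ∈ edgeVerts (R j) ∧ (f ∩ R j).Nonempty := by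
  rw [Finset.mem_sdiff, mem_AA] at hf
  obtain ⟨hfF, hfA⟩ := hf
  have hfi : f ≠ R i := fun hc => hfA ⟨i, hc.symm⟩
  have h1 := h.fdeg f hfF u (mem_ev_left huf)
  unfold deg at h1
  obtain ⟨e, he, hne⟩ := Finset.exists_mem_ne (by rw [h1]; exact one_lt_two) s(u, v)
  rw [Finset.mem_filter] at he
  obtain ⟨g, hg, heg⟩ := mem_EE.1 (hall he.1)
  obtain ⟨j, rfl⟩ := mem_AA.1 hg
  have hij : i ≠ j := by
    rintro rfl
    have h2 := h.deg_inter hfF (r.face i) hfi (mem_ev_left huf) (mem_ev_left hui)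
    unfold deg at h2
    have h3 : 1 < ((f ∩ R i).filter fun e => u ∈ e).card := by
      rw [Finset.one_lt_card]
      refine ⟨e, ?_, s(u, v), ?_, hne⟩
      · rw [Finset.mem_filter, Finset.mem_inter]
        exact ⟨⟨he.1, heg⟩, he.2⟩
      · rw [Finset.mem_filter, Finset.mem_inter]
        exact ⟨⟨huf, hui⟩, by simp⟩
    omega
  have huj : u ∈ edgeVerts (R j) := mem_ev.2 ⟨e, heg, he.2⟩
  exact ⟨j, r.nb hij (mem_ev_left hui) huj, huj, e, Finset.mem_inter.2 ⟨he.1, heg⟩⟩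

theorem Rg.succ_mem {Fs : Finset (Finset (Sym2 V))} {k : ℕ} [NeZero k]
    {R : ZMod k → Finset (Sym2 V)} (r : Rg Fs k R) (h : Ful Fs) (hk : 7 ≤ k)
    {f : Finset (Sym2 V)} (hf : f ∈ Fs \ AA R) (hall : f ⊆ EE (AA R)) {i : ZMod k}
    (hi : (f ∩ R i).Nonempty) : (f ∩ R (i + 1)).Nonempty := by
  have z1 := zne1 hk
  obtain ⟨e, he⟩ := hi
  rw [Finset.mem_inter] at he
  obtain ⟨hef, hei⟩ := he
  induction e with
  | _ u v =>
  have huv : u ≠ v := by simpa using h.fnd (r.face i) _ hei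
  obtain ⟨j, hj, huj, hfj⟩ := r.other h hf hall hef hei
  obtain ⟨l, hl, hvl, hfl⟩ := r.other h hf hall (u := v) (v := u)
    (by rw [Sym2.eq_swap]; exact hef) (by rw [Sym2.eq_swap]; exact hei)
  rcases hj with rfl | hj
  · exact hfj
  rcases hl with rfl | hl
  · exact hfl
  exfalso
  have hjl : j = l := by linear_combination hl - hj
  subst hjl
  obtain rfl : j = i - 1 := by linear_combination -hj
  have h2 := (r.inter2 h hk i).2
  have hiv : u ∈ edgeVerts (R i) := mem_ev_left hei
  have hvv : v ∈ edgeVerts (R i) := mem_ev_right hei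
  obtain ⟨e', h'i, h'j, hue⟩ := h.share (r.face i) (r.face (i - 1)) hiv huj
  obtain ⟨w, rfl⟩ := hue
  have huw : u ≠ w := by simpa using h.fnd (r.face i) _ h'i
  have hsub : ({u, v} : Finset V) ⊆ edgeVerts (R i) ∩ edgeVerts (R (i - 1)) := by
    intro x hx
    simp only [Finset.mem_insert, Finset.mem_singleton] at hx
    rw [Finset.mem_inter]
    rcases hx with rfl | rfl
    · exact ⟨hiv, huj⟩
    · exact ⟨hvv, hvl⟩
  have heq := Finset.eq_of_subset_of_card_le hsub (by rw [h2, Finset.card_pair huv])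
  have hw : w ∈ edgeVerts (R i) ∩ edgeVerts (R (i - 1)) :=
    Finset.mem_inter.2 ⟨mem_ev_right h'i, mem_ev_right h'j⟩
  rw [← heq] at hw
  simp only [Finset.mem_insert, Finset.mem_singleton] at hw
  rcases hw with rfl | rfl
  · exact huw rfl
  · rw [Finset.mem_sdiff, mem_AA] at hf
    refine h.three_faces hf.1 (r.face i) (r.face (i - 1)) hef hei h'j
      (fun hc => hf.2 ⟨_, hc.symm⟩) (fun hc => hf.2 ⟨_, hc.symm⟩) ?_
    intro hc
    have := r.inj hc
    exact z1 (by linear_combination this)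

theorem Rg.no_iso {Fs : Finset (Finset (Sym2 V))} {k : ℕ} [NeZero k]
    {R : ZMod k → Finset (Sym2 V)} (r : Rg Fs k R) (h : Ful Fs) (hk : 7 ≤ k)
    {f : Finset (Sym2 V)} (hf : f ∈ Fs \ AA R) : ∃ e ∈ f, e ∉ EE (AA R) := by
  by_contra hcon
  push Not at hcon
  have hall : f ⊆ EE (AA R) := hcon
  have hf' := hf
  rw [Finset.mem_sdiff, mem_AA] at hf'
  obtain ⟨v, hv⟩ := h.fne hf'.1
  obtain ⟨e, he, _⟩ := mem_ev.1 hv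
  obtain ⟨g, hg, heg⟩ := mem_EE.1 (hall he)
  obtain ⟨i, rfl⟩ := mem_AA.1 hg
  have h0 : (f ∩ R i).Nonempty := ⟨e, Finset.mem_inter.2 ⟨he, heg⟩⟩
  have h1 : ∀ m : ℕ, (f ∩ R (i + m)).Nonempty := by
    intro m
    induction m with
    | zero => simpa using h0
    | succ m ih =>
      have := r.succ_mem h hk hf hall ih
      push_cast
      rwa [← add_assoc]
  have h2 : ∀ j : ZMod k, (f ∩ R j).Nonempty := by
    intro j
    have := h1 (j - i).val
    rw [ZMod.natCast_zmod_val] at this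
    simpa using this
  choose c hc using h2
  have h3 : (Finset.univ : Finset (ZMod k)).card ≤ f.card := by
    apply Finset.card_le_card_of_injOn c
    · intro j _
      exact (Finset.mem_inter.1 (hc j)).1
    · intro a _ b _ hab
      by_contra hne
      have ha := Finset.mem_inter.1 (hc a)
      have hb := Finset.mem_inter.1 (hc b)
      refine h.three_faces hf'.1 (r.face a) (r.face b) ha.1 ha.2 (by rw [hab]; exact hb.2)
        (fun hc => hf'.2 ⟨_, hc.symm⟩) (fun hc => hf'.2 ⟨_, hc.symm⟩) (fun hc => hne (r.inj hc))
  rw [Finset.card_univ, ZMod.card] at h3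
  have := h.sz f hf'.1
  omega

theorem Rg.twoH {Fs : Finset (Finset (Sym2 V))} {k : ℕ} [NeZero k]
    {R : ZMod k → Finset (Sym2 V)} (r : Rg Fs k R) (h : Ful Fs) (hk : 7 ≤ k)
    {f : Finset (Sym2 V)} (hf : f ∈ KK (Fs \ AA R)) :
    2 ≤ ((HH Fs (Fs \ AA R)).filter fun v => v ∈ edgeVerts f).card := by
  have hfC := KK_sub _ hf
  have hCF : Fs \ AA R ⊆ Fs := Finset.sdiff_subset
  obtain ⟨e, he, heA⟩ := r.no_iso h hk hfC
  have heF : e ∈ EE Fs := mem_EE.2 ⟨f, hCF hfC, he⟩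
  rw [← ends_two e (h.nd e heF)]
  apply Finset.card_le_card
  intro u hu
  rw [Finset.mem_filter] at hu
  have huf : u ∈ edgeVerts f := mem_ev.2 ⟨e, he, hu.2⟩
  rw [Finset.mem_filter]
  refine ⟨?_, huf⟩
  have hle : Q (Fs \ AA R) u ≤ 2 := by
    have := hf
    unfold KK at this
    exact (Finset.mem_filter.1 this).2 u huf
  have hge : 2 ≤ Q (Fs \ AA R) u := by
    rw [← h.two e heF]
    apply Finset.card_le_card
    intro g hg
    rw [Finset.mem_filter] at hg ⊢
    refine ⟨Finset.mem_sdiff.2 ⟨hg.1, ?_⟩, mem_ev.2 ⟨e, hg.2, hu.2⟩⟩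
    intro hgA
    exact heA (mem_EE.2 ⟨g, hgA, hg.2⟩)
  have h2 : Q (Fs \ AA R) u = 2 := by omega
  unfold HH
  rw [Finset.mem_filter]
  refine ⟨Finset.mem_univ _, h2, ?_⟩
  intro hI
  have hN : u ∈ NN Fs (Fs \ AA R) := by
    unfold NN
    rw [Finset.mem_filter]
    exact ⟨Finset.mem_univ _, h2, hI⟩
  have h3 := h.QK_N hCF hN
  have h4 : 0 < Q (KK (Fs \ AA R)) u := Q_pos.2 ⟨f, hf, huf⟩
  omega

theorem Rg.KH {Fs : Finset (Finset (Sym2 V))} {k : ℕ} [NeZero k]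
    {R : ZMod k → Finset (Sym2 V)} (r : Rg Fs k R) (h : Ful Fs) (hk : 7 ≤ k) :
    (KK (Fs \ AA R)).card ≤ (HH Fs (Fs \ AA R)).card := by
  have h1 := Finset.sum_card_bipartiteAbove_eq_sum_card_bipartiteBelow
    (s := KK (Fs \ AA R)) (t := HH Fs (Fs \ AA R)) (fun f v => v ∈ edgeVerts f)
  simp only [Finset.bipartiteAbove, Finset.bipartiteBelow] at h1
  have h2 := Finset.sum_le_sum (fun f hf => r.twoH h hk (f := f) hf)
  have h3 : ∑ v ∈ HH Fs (Fs \ AA R), ((KK (Fs \ AA R)).filter fun f => v ∈ edgeVerts f).card ≤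
      ∑ v ∈ HH Fs (Fs \ AA R), 2 := by
    apply Finset.sum_le_sum
    intro v hv
    unfold HH at hv
    rw [Finset.mem_filter] at hv
    rw [← hv.2.1]
    exact Q_mono (KK_sub _) v
  simp only [Finset.sum_const, smul_eq_mul] at h2 h3
  omega

theorem Rg.final {Fs : Finset (Finset (Sym2 V))} {k : ℕ} [NeZero k]
    {R : ZMod k → Finset (Sym2 V)} (r : Rg Fs k R) (h : Ful Fs) (hk : 7 ≤ k) (hk12 : k ≤ 12) :
    Fs.card ≤ 28 := by
  have hcF := Finset.card_sdiff_add_card_eq_card r.sub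
  rw [r.card] at hcF
  have hCF : Fs \ AA R ⊆ Fs := Finset.sdiff_subset
  have hc : Conn (Fs \ (Fs \ AA R)) := by
    rw [Finset.sdiff_sdiff_eq_self r.sub]
    exact r.conn h hk
  obtain ⟨hX, hs⟩ := r.XC h hk
  have hKH := r.KH h hk
  have hpc := pc_sdiff r.sub
  rw [r.pc, h.twelve] at hpc
  generalize Fs \ AA R = C at *
  have hO := Om_eq C
  have h1 := h.step1 hCF
  have h2 := NH Fs C
  have h3 := BK_card (h.KB hCF)
  have h4 := Finset.card_sdiff_add_card_eq_card (BB_sub C)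
  by_cases hne : (C \ BB C).Nonempty
  swap
  · rw [Finset.not_nonempty_iff_eq_empty] at hne
    rw [hne] at h4
    simp at h4
    omega
  have h5 := h.step4B hCF hc (h.Knonempty hCF hne)
  have h6 := h.step3 hCF
  have h7 := pc_sdiff (BB_sub C)
  have hO1 : Om (C \ BB C) ≤ 14 := by omega
  have hC1F : C \ BB C ⊆ Fs := Finset.sdiff_subset.trans hCF
  have hc1 := h.conn_sub hCF hc le_rfl
  suffices hsuf : (C \ BB C).card + 2 * k ≤ 28 by omega
  have hp1 : FG.pc (C \ BB C) + k ≤ 12 := by omega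
  clear h1 h2 h3 h4 h5 h6 h7 hO hX hs hKH hpc hcF
  generalize C \ BB C = C1 at *
  rcases h.split hC1F hc1 hne with h8 | h8 | ⟨hB, h8, h9⟩
  · omega
  · omega
  · have h10 := h.key (Finset.sdiff_subset.trans hC1F) hB (h.conn_sub hC1F hc1 le_rfl)
    have h11 := Om_eq (C1 \ BB C1)
    have h12 := pc_sdiff (BB_sub C1)
    have hk10 : k ≤ 10 := by omega
    obtain ⟨w, rfl⟩ : ∃ w, k = 10 - w := ⟨10 - k, by omega⟩
    have h13 := h.ind (10 - (10 - w)) (C1 \ BB C1) (Finset.sdiff_subset.trans hC1F)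
      (h.conn_sub hC1F hc1 le_rfl) (by omega) (by omega)
    have hw : 10 - (10 - w) ≤ 3 := by omega
    generalize hz : 10 - (10 - w) = z at *
    interval_cases z <;> simp at h13 <;> omega

/-- Lemma 3.1. If a fullerene graph `F_n` contains a pentagonal ring
`R_k` with `7 ≤ k ≤ 12` as a subgraph, then `n ≤ 52`. -/
theorem statement_4 (P : PlaneGraph V) (hP : IsFullerene P) (k : ℕ)
    (hk7 : 7 ≤ k) (hk12 : k ≤ 12)
    (R : ZMod k → Finset (Sym2 V)) (hR : IsPentRing P k R) :
    Fintype.card V ≤ 52 := by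
  have h := ful_of P hP
  have : NeZero k := ⟨by omega⟩
  have r : Rg P.faces k R := ⟨hR.1, fun i => (hR.2.1 i).1, fun i => (hR.2.1 i).2, hR.2.2⟩
  have h1 := r.final h hk7 hk12
  have h2 := P.euler
  have h3 := Q_sum P.faces
  rw [Finset.sum_congr rfl (fun f hf => h.cardv hf),
    Finset.sum_congr rfl (fun v _ => h.Q3 v)] at h3
  simp only [Finset.sum_const, Finset.card_univ, smul_eq_mul] at h3
  omega

end FG
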